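/- The two ℝ-algebras T₁ = ℝ[x,y,z]/(x² + y² + z²) and T₂ = ℝ[x,y,z]/(x² − y² − z²) are non-isomorphic, the complexification Tᵢ ⊗_ℝ ℂ of each is isomorphic as a ℂ-algebra to ℂ[x,y,z]/(xy − z²), and every commutative ℝ-algebra whose complexification is isomorphic to ℂ[x,y,z]/(xy − z²) as a ℂ-algebra is isomorphic to T₁ or T₂. (Thus the complex surface xy = z² has exactly two isomorphism classes of real forms.) -/

import Mathlib

set_option linter.unusedSectionVars false
set_option linter.unusedSimpArgs false

section
open MvPolynomial
open scoped TensorProduct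

/-- `A` is a real form of the complex algebra `B` if the complexification `ℂ ⊗[ℝ] A`
is isomorphic to `B` as a `ℂ`-algebra. -/
def IsRealForm (A : Type) [CommRing A] [Algebra ℝ A]
    (B : Type) [CommRing B] [Algebra ℂ B] : Prop :=
  Nonempty ((ℂ ⊗[ℝ] A) ≃ₐ[ℂ] B)

/-- The two real cones `x² + y² + z² = 0` and `x² - y² - z² = 0`. -/
noncomputable def cone8 : Fin 2 → MvPolynomial (Fin 3) ℝ :=
  ![X 0 ^ 2 + X 1 ^ 2 + X 2 ^ 2,
    X 0 ^ 2 - X 1 ^ 2 - X 2 ^ 2]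
end

section
set_option linter.unusedSectionVars false
set_option linter.unusedSimpArgs false
open Polynomial

section lnd
variable {A : Type*} [CommRing A] [Algebra ℂ A]

/-- exact nilpotency degree -/
def IsDeg (D : Derivation ℂ A A) (f : A) (a : ℕ) : Prop :=
  D^[a] f ≠ 0 ∧ D^[a+1] f = 0

theorem iter_zero' (D : Derivation ℂ A A) (k : ℕ) : D^[k] 0 = 0 := by
  induction k with
  | zero => rfl
  | succ k ih => rw [Function.iterate_succ_apply, map_zero, ih]

theorem iter_add' (D : Derivation ℂ A A) (k : ℕ) (f g : A) : D^[k] (f + g) = D^[k] f + D^[k] g := by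
  induction k generalizing f g with
  | zero => rfl
  | succ k ih => rw [Function.iterate_succ_apply, map_add, ih]; rfl

theorem iter_mono' (D : Derivation ℂ A A) {k l : ℕ} (h : k ≤ l) {f : A} (hf : D^[k] f = 0) :
    D^[l] f = 0 := by
  obtain ⟨m, rfl⟩ := Nat.exists_eq_add_of_le h
  rw [add_comm, Function.iterate_add_apply, hf, iter_zero']

theorem iter_mul (D : Derivation ℂ A A) (s : ℕ) : ∀ (a b : ℕ) (f g : A), a + b = s →
    D^[a+1] f = 0 → D^[b+1] g = 0 →
    D^[a+b] (f * g) = ((a+b).choose a : A) * (D^[a] f * D^[b] g) ∧ D^[a+b+1] (f*g) = 0 := by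
  induction s with
  | zero =>
    intro a b f g hs hf hg
    obtain ⟨rfl, rfl⟩ : a = 0 ∧ b = 0 := by omega
    simp at hf hg ⊢
    simp [hf, hg]
  | succ s ih =>
    intro a b f g hs hf hg
    have key : ∀ m, D^[m+1] (f*g) = D^[m] (f * D g) + D^[m] (D f * g) := by
      intro m
      rw [Function.iterate_succ_apply, Derivation.leibniz, iter_add', smul_eq_mul, smul_eq_mul, mul_comm g]
    rcases a with _ | a
    · obtain ⟨b, rfl⟩ : ∃ b', b = b' + 1 := ⟨b - 1, by omega⟩
      simp at hf
      have h1 := ih 0 b f (D g) (by omega) (by simpa using hf) hg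
      simp only [zero_add] at h1 ⊢
      rw [key, key, h1.1, h1.2]
      simp [hf, iter_zero']
    · rcases b with _ | b
      · simp at hg
        have h1 := ih a 0 (D f) g (by omega) hf (by simpa using hg)
        simp only [add_zero] at h1 ⊢
        rw [key, key, h1.1, h1.2]
        simp [hg, iter_zero']
      · have h1 := ih (a+1) b f (D g) (by omega) hf hg
        have h2 := ih a (b+1) (D f) g (by omega) hf hg
        have e1 : a + 1 + (b+1) = (a+1+b) + 1 := by ring
        have e2 : a + 1 + b = a + (b + 1) := by ring
        rw [e1, key, key, h1.2]
        constructor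
        · rw [h1.1, e2, h2.1]
          have : ((a + (b+1) + 1).choose (a+1) : A) = (a+(b+1)).choose (a+1) + (a + (b+1)).choose a := by
            rw [Nat.choose_succ_succ]; push_cast; ring
          rw [this]
          simp only [Function.iterate_succ_apply]
          ring
        · rw [e2, h2.2, add_zero]

variable [IsDomain A]

theorem IsDeg.mul {D : Derivation ℂ A A} {f g : A} {a b : ℕ} (hf : IsDeg D f a) (hg : IsDeg D g b) :
    IsDeg D (f * g) (a + b) := by
  have := charZero_of_injective_algebraMap (algebraMap ℂ A).injective
  have h := iter_mul D _ a b f g rfl hf.2 hg.2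
  refine ⟨?_, h.2⟩
  rw [h.1]
  refine mul_ne_zero ?_ (mul_ne_zero hf.1 hg.1)
  exact_mod_cast (Nat.choose_pos (Nat.le_add_right a b)).ne'

theorem IsDeg.uniq {D : Derivation ℂ A A} {f : A} {a b : ℕ} (hf : IsDeg D f a) (hg : IsDeg D f b) :
    a = b := by
  by_contra h
  rcases lt_or_gt_of_ne h with h | h
  · exact hg.1 (iter_mono' D h hf.2)
  · exact hf.1 (iter_mono' D h hg.2)

theorem IsDeg.one (D : Derivation ℂ A A) : IsDeg D 1 0 := by simp [IsDeg]

theorem IsDeg.pow {D : Derivation ℂ A A} {f : A} {a : ℕ} (hf : IsDeg D f a) (n : ℕ) :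
    IsDeg D (f ^ n) (n * a) := by
  induction n with
  | zero => simpa using IsDeg.one D
  | succ n ih => rw [pow_succ, add_mul, one_mul]; exact ih.mul hf

theorem IsDeg.exists {D : Derivation ℂ A A} {f : A} (hf : f ≠ 0) (h : ∃ k, D^[k] f = 0) :
    ∃ a, IsDeg D f a := by
  classical
  have h0 := Nat.find_spec h
  have : Nat.find h ≠ 0 := fun h' => by rw [h'] at h0; exact hf h0
  refine ⟨Nat.find h - 1, Nat.find_min h (by omega), ?_⟩
  rwa [Nat.sub_add_cancel (by omega)]

theorem IsDeg.deriv {D : Derivation ℂ A A} {f : A} {a : ℕ} (hf : IsDeg D f (a+1)) : IsDeg D (D f) a :=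
  hf

theorem IsDeg.ne_zero {D : Derivation ℂ A A} {f : A} {a : ℕ} (hf : IsDeg D f a) : f ≠ 0 := by
  rintro rfl; exact hf.1 (iter_zero' D a)

theorem IsDeg.smul {D : Derivation ℂ A A} {f : A} {a : ℕ} (hf : IsDeg D f a) {c : ℂ} (hc : c ≠ 0) :
    IsDeg D (algebraMap ℂ A c * f) a := by
  have : IsDeg D (algebraMap ℂ A c) 0 := by
    constructor
    · simpa using hc
    · simp
  simpa using this.mul hf

/-- locally nilpotent -/
def LN (D : Derivation ℂ A A) : Prop := ∀ f, ∃ k, D^[k] f = 0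

theorem LN.of_adjoin {D : Derivation ℂ A A} (s : Set A) (hs : Algebra.adjoin ℂ s = ⊤)
    (h : ∀ f ∈ s, ∃ k, D^[k] f = 0) : LN D := by
  intro f
  have hf : f ∈ Algebra.adjoin ℂ s := hs ▸ trivial
  induction hf using Algebra.adjoin_induction with
  | mem x hx => exact h x hx
  | algebraMap r => exact ⟨1, by simp⟩
  | add x y _ _ hx hy =>
    obtain ⟨k, hk⟩ := hx
    obtain ⟨l, hl⟩ := hy
    exact ⟨k + l, by rw [iter_add', iter_mono' D (Nat.le_add_right k l) hk, iter_mono' D (Nat.le_add_left l k) hl, add_zero]⟩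
  | mul x y _ _ hx hy =>
    obtain ⟨k, hk⟩ := hx
    obtain ⟨l, hl⟩ := hy
    exact ⟨k+l+1, (iter_mul D _ k l x y rfl (iter_mono' D (Nat.le_succ k) hk)
      (iter_mono' D (Nat.le_succ l) hl)).2⟩

theorem LN.ker_of_mul {D : Derivation ℂ A A} (h : LN D) {f g : A} (hfg : f * g ≠ 0)
    (h0 : D (f * g) = 0) : IsDeg D f 0 ∧ IsDeg D g 0 := by
  obtain ⟨a, ha⟩ := IsDeg.exists (left_ne_zero_of_mul hfg) (h f)
  obtain ⟨b, hb⟩ := IsDeg.exists (right_ne_zero_of_mul hfg) (h g)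
  have : IsDeg D (f * g) 0 := ⟨hfg, h0⟩
  have := this.uniq (ha.mul hb)
  obtain ⟨rfl, rfl⟩ : a = 0 ∧ b = 0 := by omega
  exact ⟨ha, hb⟩

end lnd
end

section
open Polynomial

section mc
variable {A : Type*} [CommRing A] [Algebra ℂ A]

noncomputable def mc (d : Derivation ℂ A A) : Derivation ℂ A[X] A[X] :=
  Derivation.mk'
    { toFun := fun p => PolynomialModule.equivPolynomialSelf (d.mapCoeffs p)
      map_add' := by simp
      map_smul' := by
        intro r p
        ext i
        simp [PolynomialModule.equivPolynomialSelf] }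
    (by
      intro a b
      show PolynomialModule.equivPolynomialSelf (d.mapCoeffs (a * b)) = _
      rw [Derivation.leibniz, map_add, map_smul, map_smul]
      rfl)

theorem mc_coeff (d : Derivation ℂ A A) (p : A[X]) (i : ℕ) : (mc d p).coeff i = d (p.coeff i) := rfl

theorem mc_natDegree_le (d : Derivation ℂ A A) (p : A[X]) {n : ℕ} (h : p.natDegree ≤ n) :
    (mc d p).natDegree ≤ n := by
  rw [natDegree_le_iff_coeff_eq_zero] at h ⊢
  intro k hk
  rw [mc_coeff, h k hk, map_zero]

theorem mc_X (d : Derivation ℂ A A) : mc d X = 0 := by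
  ext i; rw [mc_coeff, coeff_X]; split_ifs <;> simp

theorem mc_C (d : Derivation ℂ A A) (a : A) : mc d (C a) = C (d a) := by
  ext i; rw [mc_coeff, coeff_C, coeff_C]; split_ifs <;> simp

theorem mc_X_pow_mul (d : Derivation ℂ A A) (k : ℕ) (p : A[X]) : mc d (X^k * p) = X^k * mc d p := by
  simp [mc_X, Derivation.leibniz, Derivation.leibniz_pow]

end mc

/-- the ring `ℂ[v][u]` -/
abbrev RR := Polynomial (Polynomial ℂ)

noncomputable def uu : RR := X
noncomputable def vv : RR := C X

noncomputable def du : Derivation ℂ RR RR := (derivative' (R := Polynomial ℂ)).restrictScalars ℂ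
noncomputable def dv : Derivation ℂ RR RR := mc derivative'

theorem du_apply (f : RR) : du f = derivative f := rfl
theorem du_uu : du uu = 1 := by simp [du_apply, uu]
theorem du_vv : du vv = 0 := by simp [du_apply, vv]
theorem dv_uu : dv uu = 0 := mc_X _
theorem dv_vv : dv vv = 1 := by simp [dv, vv, mc_C]

theorem coeff_du (f : RR) (i j : ℕ) :
    ((du f).coeff i).coeff j = (f.coeff (i+1)).coeff j * (i+1) := by
  rw [du_apply, coeff_derivative]
  rw [show ((i : ℂ[X]) + 1) = C ((i:ℂ)+1) by simp, coeff_mul_C]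

theorem coeff_dv (f : RR) (i j : ℕ) :
    ((dv f).coeff i).coeff j = (f.coeff i).coeff (j+1) * (j+1) := by
  rw [dv, mc_coeff]
  exact coeff_derivative _ _

theorem adjoin_uv : Algebra.adjoin ℂ ({uu, vv} : Set RR) = ⊤ := by
  rw [eq_top_iff]
  rintro f -
  induction f using Polynomial.induction_on' with
  | add p q hp hq => exact add_mem hp hq
  | monomial n a =>
    rw [← C_mul_X_pow_eq_monomial]
    refine mul_mem ?_ (pow_mem (Algebra.subset_adjoin (by simp [uu])) n)
    induction a using Polynomial.induction_on' with
    | add p q hp hq => rw [C_add]; exact add_mem hp hq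
    | monomial m c =>
      rw [← C_mul_X_pow_eq_monomial, C_mul, C_pow]
      exact mul_mem (Subalgebra.algebraMap_mem _ c) (pow_mem (Algebra.subset_adjoin (by simp [vv])) m)

/-- Any derivation is determined by its values on `u, v`. -/
theorem der_eq (D : Derivation ℂ RR RR) (f : RR) : D f = D uu * du f + D vv * dv f := by
  have : D = D uu • du + D vv • dv := by
    apply Derivation.ext_of_adjoin_eq_top _ adjoin_uv
    intro x hx
    rcases hx with rfl | rfl <;> simp [du_uu, du_vv, dv_uu, dv_vv]
  conv_lhs => rw [this]
  simp

/-- Hamiltonian derivation -/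
noncomputable def ham (G : RR) : Derivation ℂ RR RR := du G • dv - dv G • du

theorem ham_apply (G f : RR) : ham G f = du G * dv f - dv G * du f := by simp [ham]
theorem ham_self (G : RR) : ham G G = 0 := by rw [ham_apply]; ring
theorem ham_uu (G : RR) : ham G uu = - dv G := by simp [ham_apply, du_uu, dv_uu]
theorem ham_vv (G : RR) : ham G vv = du G := by simp [ham_apply, du_vv, dv_vv]

/-- weight homomorphism -/
noncomputable def lam (p q : ℕ) : RR →ₐ[ℂ] Polynomial RR :=
  aevalAeval (C vv * X ^ q) (C uu * X ^ p)

theorem lam_uu (p q : ℕ) : lam p q uu = C uu * X ^ p := by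
  rw [lam, uu]; exact aevalAeval_Y _ _
theorem lam_vv (p q : ℕ) : lam p q vv = C vv * X ^ q := by
  rw [lam, vv]; exact aevalAeval_X _ _
theorem lam_CC (p q : ℕ) (c : ℂ) : lam p q (C (C c)) = C (C (C c)) := (lam p q).commutes c

theorem mono_eq (i j : ℕ) (c : ℂ) : (monomial i (monomial j c) : RR) = C (C c) * vv^j * uu^i := by
  rw [← C_mul_X_pow_eq_monomial, ← C_mul_X_pow_eq_monomial, C_mul, C_pow]; rfl

theorem lam_mono (p q i j : ℕ) (c : ℂ) : lam p q (monomial i (monomial j c)) =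
    monomial (p*i+q*j) (monomial i (monomial j c)) := by
  rw [mono_eq, map_mul, map_mul, map_pow, map_pow, lam_uu, lam_vv, lam_CC, ← C_mul_X_pow_eq_monomial]
  simp only [C_mul, C_pow, mul_pow, ← pow_mul]
  ring

theorem RR_induction {P : RR → Prop} (f : RR) (hadd : ∀ f g, P f → P g → P (f + g))
    (hm : ∀ i j c, P (monomial i (monomial j c))) : P f := by
  induction f using Polynomial.induction_on' with
  | add p q hp hq => exact hadd _ _ hp hq
  | monomial n a =>
    induction a using Polynomial.induction_on' with
    | add p q hp hq => rw [map_add]; exact hadd _ _ hp hq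
    | monomial m c => exact hm _ _ _

theorem lam_coeff (p q : ℕ) (f : RR) (d i j : ℕ) : (((lam p q f).coeff d).coeff i).coeff j =
    if p*i+q*j = d then (f.coeff i).coeff j else 0 := by
  induction f using RR_induction with
  | hadd f g hf hg => rw [map_add, coeff_add, coeff_add, coeff_add, hf, hg]; split_ifs <;> simp
  | hm i' j' c =>
    rw [lam_mono]
    simp only [coeff_monomial]
    by_cases h1 : i' = i
    · by_cases h2 : j' = j
      · subst h1 h2
        by_cases hd : p * i' + q * j' = d <;> simp [hd]
      · simp only [h1, if_true]; split_ifs <;> simp [coeff_monomial, h2]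
    · simp only [h1, if_false]; split_ifs <;> simp [coeff_monomial, h1]

theorem lam_natDegree_le (p q : ℕ) (f : RR) (d : ℕ) :
    (lam p q f).natDegree ≤ d ↔ ∀ i j, (f.coeff i).coeff j ≠ 0 → p*i+q*j ≤ d := by
  rw [natDegree_le_iff_coeff_eq_zero]
  constructor
  · intro h i j hij
    by_contra hc
    have := h (p*i+q*j) (by omega)
    have h2 := lam_coeff p q f (p*i+q*j) i j
    rw [this] at h2
    simp at h2
    exact hij h2.symm
  · intro h k hk
    ext i j
    rw [lam_coeff]
    split_ifs with hh
    · by_contra hc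
      have := h i j hc
      omega
    · simp

theorem lam_du (p q : ℕ) (f : RR) : X^p * lam p q (du f) = mc du (lam p q f) := by
  ext d i j
  rw [coeff_X_pow_mul', mc_coeff, coeff_du, lam_coeff]
  split_ifs with h1 h2 h2
  · rw [lam_coeff, coeff_du, if_pos]
    rw [mul_add] at h2; omega
  · rw [lam_coeff, if_neg]
    · simp
    rw [mul_add] at h2; omega
  · rw [mul_add] at h2; omega
  · simp

theorem lam_dv (p q : ℕ) (f : RR) : X^q * lam p q (dv f) = mc dv (lam p q f) := by
  ext d i j
  rw [coeff_X_pow_mul', mc_coeff, coeff_dv, lam_coeff]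
  split_ifs with h1 h2 h2
  · rw [lam_coeff, coeff_dv, if_pos]
    rw [mul_add] at h2; omega
  · rw [lam_coeff, if_neg]
    · simp
    rw [mul_add] at h2; omega
  · rw [mul_add] at h2; omega
  · simp

theorem lam_ham (p q : ℕ) (G f : RR) : X^(p+q) * lam p q (ham G f) =
    mc du (lam p q G) * mc dv (lam p q f) - mc dv (lam p q G) * mc du (lam p q f) := by
  rw [← lam_du, ← lam_dv, ← lam_du, ← lam_dv, ham_apply, map_sub, map_mul, map_mul]
  ring

theorem lam_iter (p q : ℕ) (G f : RR) (d e : ℕ) (hG : (lam p q G).natDegree ≤ d)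
    (hf : (lam p q f).natDegree ≤ e) (k : ℕ) :
    (X^(k*(p+q)) * lam p q ((ham G)^[k] f)).natDegree ≤ k * d + e ∧
    (X^(k*(p+q)) * lam p q ((ham G)^[k] f)).coeff (k*d+e) =
      (ham ((lam p q G).coeff d))^[k] ((lam p q f).coeff e) := by
  induction k with
  | zero => simpa using hf
  | succ k ih =>
    rw [Function.iterate_succ_apply', Function.iterate_succ_apply']
    set H := (X^(k*(p+q)) * lam p q ((ham G)^[k] f)) with hH
    have e1 : X^((k+1)*(p+q)) * lam p q (ham G ((ham G)^[k] f)) =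
        mc du (lam p q G) * mc dv H - mc dv (lam p q G) * mc du H := by
      rw [add_mul, one_mul, pow_add, mul_assoc, lam_ham, hH, mc_X_pow_mul, mc_X_pow_mul]
      ring
    have e2 : (k+1)*d+e = d + (k*d+e) := by ring
    rw [e1, e2]
    constructor
    · refine (natDegree_sub_le _ _).trans (max_le ?_ ?_) <;>
      exact natDegree_mul_le_of_le (mc_natDegree_le _ _ hG) (mc_natDegree_le _ _ ih.1)
    · rw [coeff_sub, coeff_mul_add_eq_of_natDegree_le (mc_natDegree_le _ _ hG) (mc_natDegree_le _ _ ih.1),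
        coeff_mul_add_eq_of_natDegree_le (mc_natDegree_le _ _ hG) (mc_natDegree_le _ _ ih.1)]
      simp only [mc_coeff]
      rw [ih.2, ham_apply]

theorem LN_top (p q : ℕ) (G : RR) (hG : LN (ham G)) (d : ℕ) (hd : (lam p q G).natDegree ≤ d) :
    LN (ham ((lam p q G).coeff d)) := by
  apply LN.of_adjoin _ adjoin_uv
  intro x hx
  have hk : ∃ e, (lam p q x).natDegree ≤ e ∧ (lam p q x).coeff e = x := by
    rcases hx with rfl | rfl
    · refine ⟨p, ?_, ?_⟩
      · rw [lam_uu]; exact natDegree_C_mul_X_pow_le _ _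
      · rw [lam_uu]; simp
    · refine ⟨q, ?_, ?_⟩
      · rw [lam_vv]; exact natDegree_C_mul_X_pow_le _ _
      · rw [lam_vv]; simp
  obtain ⟨e, he, hx'⟩ := hk
  obtain ⟨k, hk⟩ := hG x
  refine ⟨k, ?_⟩
  have := (lam_iter p q G x d e hd he k).2
  rw [hk, map_zero, hx'] at this
  rw [← this]; simp
end

section
open Polynomial

theorem der_CC (D : Derivation ℂ RR RR) (c : ℂ) : D (C (C c)) = 0 := D.map_algebraMap c

theorem S1 (G : RR) (hG : LN (ham G)) (hn : 1 ≤ G.natDegree) :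
    ∃ c : ℂ, c ≠ 0 ∧ G.coeff G.natDegree = C c := by
  set n := G.natDegree with hn'
  set a := G.coeff n with ha
  have hG0 : G ≠ 0 := by rintro rfl; simp at hn'; omega
  have ha0 : a ≠ 0 := by rw [ha, hn', coeff_natDegree]; simpa using hG0
  have hd : (lam 1 0 G).natDegree ≤ n := by
    rw [lam_natDegree_le]
    intro i j hij
    have : G.coeff i ≠ 0 := by rintro h; simp [h] at hij
    have := le_natDegree_of_ne_zero this
    omega
  have hP : (lam 1 0 G).coeff n = (C a * uu^(n-1)) * uu := by
    rw [mul_assoc, ← pow_succ, Nat.sub_add_cancel hn]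
    ext i j
    rw [lam_coeff, uu, coeff_C_mul, coeff_X_pow]
    by_cases h : i = n
    · subst h; simp
      rfl
    · rw [if_neg (by omega)]; simp [h]
  have hL := LN_top 1 0 G hG n hd
  set P := (lam 1 0 G).coeff n with hPdef
  have hP0 : P ≠ 0 := by
    rw [hP]
    have : uu ≠ 0 := X_ne_zero
    exact mul_ne_zero (mul_ne_zero (by simpa using ha0) (pow_ne_zero _ this)) this
  have h1 := (hL.ker_of_mul (hP ▸ hP0) (by rw [← hP]; exact ham_self P)).2.2
  simp [ham_uu] at h1
  have h2 : derivative a = 0 := by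
    have h3 : (dv P).coeff n = derivative a := by
      rw [hP, mul_assoc, ← pow_succ, Nat.sub_add_cancel hn, dv, mc_coeff, uu, coeff_C_mul, coeff_X_pow]
      simp
    rw [← h3, h1]; simp
  have h3 := derivative_eq_zero.1 h2
  obtain ⟨c, hc⟩ := natDegree_eq_zero.1 h3
  refine ⟨c, ?_, hc.symm⟩
  rintro rfl
  exact ha0 (by rw [← hc]; simp)

theorem hom_aux {K : Type*} [Field K] (S T c : K) (hT : T ≠ 0) (k m : ℕ) :
    T^k * T^m * (c * (S^k/T^k)) = c * S^k * T^m := by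
  field_simp

theorem hom_fac {A : Type*} [CommRing A] [IsDomain A] [Algebra ℂ A] (f : ℂ[X]) (s t : A) (ht : t ≠ 0) :
    ∑ k ∈ Finset.range (f.natDegree + 1), algebraMap ℂ A (f.coeff k) * s^k * t^(f.natDegree - k) =
    algebraMap ℂ A f.leadingCoeff * (f.roots.map (fun r => s - algebraMap ℂ A r * t)).prod := by
  let K := FractionRing A
  have hinj : Function.Injective (algebraMap A K) := IsFractionRing.injective A K
  apply hinj
  have ht' : algebraMap A K t ≠ 0 := by simpa using ht
  set S := algebraMap A K s
  set T := algebraMap A K t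
  have hsp := IsAlgClosed.splits f
  have h1 : aeval (S / T) f = algebraMap ℂ K f.leadingCoeff *
      (f.roots.map (fun r => S/T - algebraMap ℂ K r)).prod := by
    conv_lhs => rw [hsp.eq_prod_roots]
    rw [map_mul, aeval_C, map_multiset_prod, Multiset.map_map]
    simp
  have h2 : T ^ f.natDegree * aeval (S/T) f = algebraMap ℂ K f.leadingCoeff *
      (f.roots.map (fun r => S - algebraMap ℂ K r * T)).prod := by
    rw [h1, hsp.natDegree_eq_card_roots, mul_left_comm]
    congr 1
    have h5 : (f.roots.map (fun r => T * (S/T - algebraMap ℂ K r))).prod =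
        T ^ f.roots.card * (f.roots.map (fun r => S/T - algebraMap ℂ K r)).prod := by
      rw [Multiset.prod_map_mul, Multiset.map_const', Multiset.prod_replicate]
    rw [← h5]
    congr 1
    apply Multiset.map_congr rfl
    intro r _
    rw [mul_sub, mul_div_cancel₀ _ ht', mul_comm T]
  rw [map_mul, map_multiset_prod, Multiset.map_map]
  have h3 : ∀ z : ℂ, algebraMap A K (algebraMap ℂ A z) = algebraMap ℂ K z := fun z =>
    (IsScalarTower.algebraMap_apply ℂ A K z).symm
  have h4 : (⇑(algebraMap A K) ∘ fun r => s - algebraMap ℂ A r * t) =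
      fun r => S - algebraMap ℂ K r * T := by
    ext r; simp [h3, S, T]
  rw [h4, h3, ← h2, aeval_eq_sum_range, Finset.mul_sum, map_sum]
  apply Finset.sum_congr rfl
  intro k hk
  have hk : k ≤ f.natDegree := by simpa [Nat.lt_succ_iff] using hk
  rw [map_mul, map_mul, map_pow, map_pow, h3, Algebra.smul_def, div_pow]
  obtain ⟨m, hm⟩ := Nat.exists_eq_add_of_le hk
  rw [hm, Nat.add_sub_cancel_left, pow_add]
  exact (hom_aux S T _ ht' k m).symm

theorem arith1 (p q a b : ℕ) (hq : 1 ≤ q) (hpq : q ≤ p) (ha : 1 ≤ a) (hb : 1 ≤ b)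
    (h1 : (q-1)*a = b-1) (h2 : (p-1)*b=a-1) : q = 1 := by
  by_contra h
  obtain ⟨q, rfl⟩ : ∃ q', q = q'+2 := ⟨q-2, by omega⟩
  obtain ⟨p, rfl⟩ : ∃ q', p = q'+2 := ⟨p-2, by omega⟩
  have e1 : (q+1) * a = b - 1 := h1
  have e2 : (p+1) * b = a - 1 := h2
  have : a ≤ (q+1)*a := Nat.le_mul_of_pos_left _ (by omega)
  have : b ≤ (p+1)*b := Nat.le_mul_of_pos_left _ (by omega)
  omega

/-- the expansion of a weighted homogeneous polynomial -/
theorem S3_expand (P : RR) (n p q : ℕ) (hp : 1 ≤ p) (hq : 1 ≤ q) (hpq : Nat.Coprime p q)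
    (hP : ∀ i j, (P.coeff i).coeff j ≠ 0 → p*i+q*j = p*n) :
    P = uu^(n-q*(n/q)) * ∑ k ∈ Finset.range (n/q+1),
      algebraMap ℂ RR ((P.coeff (n-q*(n/q)+q*k)).coeff (p*(n/q-k))) * (uu^q)^k * (vv^p)^(n/q-k) := by
  set T := n/q with hT
  set e := n - q*T with he
  have hen : e + q*T = n := by have := Nat.mul_div_le n q; rw [← hT] at this; omega
  rw [Finset.mul_sum]
  have h1 : ∀ k, uu^e * (algebraMap ℂ RR ((P.coeff (e+q*k)).coeff (p*(T-k))) * (uu^q)^k * (vv^p)^(T-k))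
      = monomial (e+q*k) (monomial (p*(T-k)) ((P.coeff (e+q*k)).coeff (p*(T-k)))) := by
    intro k
    rw [mono_eq, ← pow_mul, ← pow_mul, pow_add]
    change uu^e * (C (C _) * _ * _) = _
    ring
  simp only [h1]
  ext i j
  simp only [finsetSum_coeff, coeff_monomial]
  by_cases h : ∃ k, k ≤ T ∧ i = e+q*k ∧ j = p*(T-k)
  · obtain ⟨k, hk, rfl, rfl⟩ := h
    rw [Finset.sum_eq_single k]
    · simp
    · intro k' _ hne
      have : e + q*k' ≠ e+q*k := by
        intro h
        have : q*k' = q*k := by omega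
        exact hne (Nat.eq_of_mul_eq_mul_left (by omega) this)
      rw [if_neg this]; simp
    · intro hk'; simp at hk'; omega
  · rw [Finset.sum_eq_zero]
    · by_contra hc
      apply h
      have h2 := hP i j hc
      have hin : i ≤ n := by
        by_contra h'
        have : p * n < p * i := Nat.mul_lt_mul_of_pos_left (by omega) hp
        omega
      obtain ⟨m, rfl⟩ := Nat.exists_eq_add_of_le hin
      have h3 : q * j = p * m := by rw [mul_add] at h2; omega
      have h4 : q ∣ m := (Nat.Coprime.symm hpq).dvd_of_dvd_mul_left ⟨j, h3.symm⟩
      obtain ⟨t, rfl⟩ := h4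
      have h5 : j = p * t := by
        apply Nat.eq_of_mul_eq_mul_left (show 0 < q by omega); rw [h3]; ring
      have h6 : t ≤ T := by
        rw [hT, Nat.le_div_iff_mul_le (by omega)]; nlinarith
      refine ⟨T - t, by omega, ?_, ?_⟩
      · rw [Nat.mul_sub]
        have : q * t ≤ q * T := Nat.mul_le_mul_left _ h6
        omega
      · rw [h5]; congr 1; omega
    · intro k hk
      simp at hk
      by_cases h2 : e+q*k = i
      · have : p*(T-k) ≠ j := fun h3 => h ⟨k, by omega, h2.symm, h3.symm⟩
        simp [h2, coeff_monomial, this]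
      · simp [h2]

theorem S3_core (P : RR) (hL : LN (ham P)) (n p q : ℕ) (hn : 1 ≤ n) (hq : 1 ≤ q) (hqp : q ≤ p) (hqn : q ≤ n)
    (hpq : Nat.Coprime p q) (hP : ∀ i j, (P.coeff i).coeff j ≠ 0 → p*i+q*j = p*n)
    (c : ℂ) (hc : c ≠ 0) (hcn : (P.coeff n).coeff 0 = c) (i1 j1 : ℕ) (hj1 : 1 ≤ j1)
    (hij : (P.coeff i1).coeff j1 ≠ 0) : P.coeff (n-1) ≠ 0 := by
  have hu0 : uu ≠ 0 := X_ne_zero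
  have hv0 : vv ≠ 0 := by simp [vv]
  have hex := S3_expand P n p q (by omega) hq hpq hP
  set T := n/q with hT
  have hT1 : 1 ≤ T := (Nat.one_le_div_iff (by omega)).2 hqn
  set e := n - q*T with he
  have hen : e + q*T = n := by have := Nat.mul_div_le n q; rw [← hT] at this; omega
  let f : ℂ[X] := ∑ k ∈ Finset.range (T+1), monomial k ((P.coeff (e+q*k)).coeff (p*(T-k)))
  have hfc : ∀ k, k ≤ T → f.coeff k = (P.coeff (e+q*k)).coeff (p*(T-k)) := by
    intro k hk
    simp only [f, finsetSum_coeff, coeff_monomial]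
    rw [Finset.sum_ite_eq' ]
    simp; omega
  have hfT : f.coeff T = c := by rw [hfc T le_rfl, hen]; simpa using hcn
  have hfd : f.natDegree = T := by
    apply natDegree_eq_of_le_of_coeff_ne_zero
    · apply natDegree_sum_le_of_forall_le
      intro k hk
      exact (natDegree_monomial_le _).trans (by simpa [Nat.lt_succ_iff] using hk)
    · rw [hfT]; exact hc
  have hfl : f.leadingCoeff = c := by rw [leadingCoeff, hfd, hfT]
  have hfac := hom_fac f (uu^q) (vv^p) (pow_ne_zero _ hv0)
  rw [hfd, hfl] at hfac
  have hP2 : P = uu^e * (algebraMap ℂ RR c * (f.roots.map (fun r => uu^q - algebraMap ℂ RR r * vv^p)).prod) := by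
    rw [← hfac]
    refine hex.trans (congrArg _ (Finset.sum_congr rfl ?_))
    intro k hk
    rw [hfc k (by simpa [Nat.lt_succ_iff] using hk)]
  have hP0 : P ≠ 0 := by rintro rfl; simp at hij
  obtain ⟨a, ha⟩ := IsDeg.exists hu0 (hL uu)
  obtain ⟨b, hb⟩ := IsDeg.exists hv0 (hL vv)
  have ha1 : 1 ≤ a := by
    by_contra h
    obtain rfl : a = 0 := by omega
    have h1 := ha.2
    simp [ham_uu] at h1
    have h2 := coeff_dv P i1 (j1-1)
    rw [h1, Nat.sub_add_cancel hj1] at h2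
    simp [hij] at h2
    norm_cast at h2
  have hb1 : 1 ≤ b := by
    by_contra h
    obtain rfl : b = 0 := by omega
    have h1 := hb.2
    simp [ham_vv] at h1
    have h2 := coeff_du P (n-1) 0
    rw [h1, Nat.sub_add_cancel hn, hcn] at h2
    simp [hc] at h2
    norm_cast at h2
  have he0 : e = 0 := by
    have h1 := (hL.ker_of_mul (hP2 ▸ hP0) (by rw [← hP2]; exact ham_self P)).1
    have := h1.uniq (ha.pow e)
    rcases Nat.mul_eq_zero.1 this.symm with h | h <;> omega
  have hroot : ∀ r ∈ f.roots, IsDeg (ham P) (uu^q - algebraMap ℂ RR r * vv^p) 0 := by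
    intro r hr
    have : (uu^q - algebraMap ℂ RR r * vv^p) ∣ P := by
      conv_rhs => rw [hP2]
      exact ((Multiset.dvd_prod (Multiset.mem_map_of_mem _ hr)).mul_left _).mul_left _
    obtain ⟨k, hk⟩ := this
    exact (hL.ker_of_mul (hk ▸ hP0) (by rw [← hk]; exact ham_self P)).1
  have hcard : f.roots.card = T := by rw [← hfd]; exact (IsAlgClosed.splits f).natDegree_eq_card_roots.symm
  obtain ⟨r, hr⟩ : ∃ r, r ∈ f.roots := Multiset.card_pos_iff_exists_mem.1 (by omega)
  have hall : ∀ r' ∈ f.roots, r' = r := by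
    intro r' hr'
    by_contra hne
    have h1 := (hroot r hr).2
    have h2 := (hroot r' hr').2
    simp only [zero_add, Function.iterate_one] at h1 h2
    have h3 : ham P (algebraMap ℂ RR (r - r') * vv^p) = 0 := by
      have : algebraMap ℂ RR (r - r') * vv^p =
        (uu^q - algebraMap ℂ RR r' * vv^p) - (uu^q - algebraMap ℂ RR r * vv^p) := by
        rw [map_sub]; ring
      rw [this, map_sub, h1, h2, sub_zero]
    have h4 : IsDeg (ham P) (algebraMap ℂ RR (r - r') * vv^p) (p*b) :=
      (hb.pow p).smul (sub_ne_zero.2 (Ne.symm hne))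
    have h5 := h4.uniq (⟨h4.ne_zero, h3⟩ : IsDeg _ _ 0)
    rcases Nat.mul_eq_zero.1 h5 with h | h <;> omega
  have hrep := Multiset.eq_replicate.2 ⟨hcard, hall⟩
  rw [hrep, Multiset.map_replicate, Multiset.prod_replicate, he0, pow_zero, one_mul] at hP2
  have hh := hroot r hr
  set h := uu^q - algebraMap ℂ RR r * vv^p with hhdef
  have hr0 : r ≠ 0 := by
    rintro rfl
    have h1 : h = uu^q := by rw [hhdef]; simp
    rw [h1] at hh
    have := hh.uniq (ha.pow q)
    rcases Nat.mul_eq_zero.1 this.symm with h | h <;> omega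
  have hduP : du P = algebraMap ℂ RR (c*T*q) * (h^(T-1) * uu^(q-1)) := by
    conv_lhs => rw [hP2]
    simp [Derivation.leibniz_pow, hhdef, du_uu, du_vv, der_CC]
    ring
  have hdvP : -dv P = algebraMap ℂ RR (c*T*r*p) * (h^(T-1) * vv^(p-1)) := by
    conv_lhs => rw [hP2]
    simp [Derivation.leibniz_pow, hhdef, dv_uu, dv_vv, der_CC]
    ring
  have hTn : (T:ℂ) ≠ 0 := by exact_mod_cast (by omega : T ≠ 0)
  have hqn' : (q:ℂ) ≠ 0 := by exact_mod_cast (by omega : q ≠ 0)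
  have hpn : (p:ℂ) ≠ 0 := by exact_mod_cast (by omega : p ≠ 0)
  have q1 : q = 1 := by
    apply arith1 p q a b hq hqp ha1 hb1
    · have e1 : IsDeg (ham P) (du P) ((q-1)*a) := by
        rw [hduP]
        have := ((hh.pow (T-1)).mul (ha.pow (q-1))).smul (c := c*T*q) (by positivity)
        simpa using this
      obtain ⟨b, rfl⟩ : ∃ b', b = b'+1 := ⟨b-1, by omega⟩
      have e2 := hb.deriv
      rw [ham_vv] at e2
      exact e1.uniq e2
    · have e1 : IsDeg (ham P) (-dv P) ((p-1)*b) := by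
        rw [hdvP]
        have := ((hh.pow (T-1)).mul (hb.pow (p-1))).smul (c := c*T*r*p) (by positivity)
        simpa using this
      obtain ⟨b, rfl⟩ : ∃ b', a = b'+1 := ⟨a-1, by omega⟩
      have e2 := ha.deriv
      rw [ham_uu] at e2
      exact e1.uniq e2
  subst q1
  have hTn' : T = n := by omega
  have hPf : P = C (C c) * (X + C (-(C r * X^p)))^n := by
    rw [hP2, hTn', hhdef]
    simp [uu, vv, sub_eq_add_neg]
  rw [hPf, coeff_C_mul, coeff_X_add_C_pow]
  have : n - (n-1) = 1 := by omega
  rw [this]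
  have hch : (n.choose (n-1)) ≠ 0 := (Nat.choose_pos (by omega)).ne'
  simp [hc, hr0, hch]

theorem S3 (G : RR) (hG : LN (ham G)) (n : ℕ) (hn : 2 ≤ n) (hd : G.natDegree = n) (c : ℂ) (hc : c ≠ 0)
    (h0 : G.coeff n = C c) (h1 : G.coeff (n-1) = 0) (i j : ℕ) (hi : i < n) (hij : (G.coeff i).coeff j ≠ 0) :
    i + j < n := by
  by_contra hcon
  let S : Finset (Σ _ : ℕ, ℕ) := (Finset.range n).sigma (fun i => (G.coeff i).support)
  have hS : ∀ x, x ∈ S ↔ x.1 < n ∧ (G.coeff x.1).coeff x.2 ≠ 0 := by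
    intro x; simp [S]
  obtain ⟨⟨i1, j1⟩, hm1, hm⟩ := S.exists_max_image (fun x => (x.2:ℚ)/((n - x.1 : ℕ):ℚ)) ⟨⟨i,j⟩, (hS _).2 ⟨hi, hij⟩⟩
  rw [hS] at hm1
  obtain ⟨hi1, hij1⟩ := hm1
  simp only at hi1 hij1
  have hmax : ∀ i j, i < n → (G.coeff i).coeff j ≠ 0 → j * (n - i1) ≤ j1 * (n - i) := by
    intro i j hi hij
    have := hm ⟨i,j⟩ ((hS _).2 ⟨hi, hij⟩)
    simp only at this
    rw [div_le_div_iff₀ (by exact_mod_cast (by omega)) (by exact_mod_cast (by omega))] at this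
    exact_mod_cast this
  obtain ⟨g, p, q, hg, hpq, hp, hq⟩ := Nat.exists_coprime' (m := j1) (n := n - i1) (Nat.gcd_pos_of_pos_right _ (by omega))
  have hq1 : 1 ≤ q := by
    by_contra h
    obtain rfl : q = 0 := by omega
    omega
  have hqp : q ≤ p := by
    have h2 := hmax i j hi hij
    have h3 : n - i ≤ j := by omega
    have h4 : (n-i)*(n-i1) ≤ j1 * (n-i) := (Nat.mul_le_mul_right _ h3).trans h2
    have h5 : n - i1 ≤ j1 := by
      rw [mul_comm] at h4
      exact Nat.le_of_mul_le_mul_right h4 (by omega)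
    rw [hp, hq] at h5
    exact Nat.le_of_mul_le_mul_right h5 hg
  have hj1 : 1 ≤ j1 := by rw [hp]; exact Nat.mul_pos (by omega) hg
  have hqn : q ≤ n := by
    have : q ≤ q * g := Nat.le_mul_of_pos_right _ hg
    omega
  have hdeg : (lam p q G).natDegree ≤ p*n := by
    rw [lam_natDegree_le]
    intro i j hij
    have hin : i ≤ n := by
      rw [← hd]; apply le_natDegree_of_ne_zero; rintro h; simp [h] at hij
    rcases Nat.lt_or_eq_of_le hin with h | h
    · have h2 := hmax i j h hij
      rw [hp, hq] at h2
      have h3 : j * q ≤ p * (n - i) := by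
        apply Nat.le_of_mul_le_mul_right _ hg
        calc j * q * g = j * (q*g) := by ring
          _ ≤ _ := h2
          _ = _ := by ring
      obtain ⟨m, rfl⟩ := Nat.exists_eq_add_of_le hin
      rw [Nat.add_sub_cancel_left] at h3
      nlinarith
    · subst h
      rw [h0, coeff_C] at hij
      have : j = 0 := by by_contra h; simp [h] at hij
      subst this; simp
  have hL := LN_top p q G hG _ hdeg
  have hco := lam_coeff p q G (p*n)
  set P := (lam p q G).coeff (p*n) with hPdef
  refine S3_core P hL n p q (by omega) hq1 hqp hqn hpq ?_ c hc ?_ i1 j1 hj1 ?_ ?_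
  · intro i j h
    by_contra h'
    rw [hco, if_neg h'] at h
    exact h rfl
  · rw [hco, h0]; simp
  · rw [hco, if_pos]
    · exact hij1
    · have : q * j1 = p * (n - i1) := by rw [hp, hq]; ring
      rw [this, ← mul_add]; congr 1; omega
  · ext j
    rw [hco, h1]; simp
end

section
open Polynomial

theorem RR_hom_ext {A : Type*} [CommRing A] {f g : RR →+* A} (hC : ∀ z, f (C (C z)) = g (C (C z)))
    (hu : f uu = g uu) (hv : f vv = g vv) : f = g := by
  apply Polynomial.ringHom_ext'
  · apply Polynomial.ringHom_ext'
    · ext z; exact hC z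
    · exact hv
  · exact hu

/-- parity involution -/
noncomputable def NN : RR →ₐ[ℂ] RR := aevalAeval (-vv) (-uu)

theorem NN_uu : NN uu = -uu := by rw [NN, uu]; exact aevalAeval_Y _ _
theorem NN_vv : NN vv = -vv := by rw [NN, vv]; exact aevalAeval_X _ _
theorem NN_CC (c : ℂ) : NN (C (C c)) = C (C c) := NN.commutes c

theorem NN_coeff (f : RR) (i j : ℕ) : ((NN f).coeff i).coeff j = (-1)^(i+j) * (f.coeff i).coeff j := by
  induction f using RR_induction with
  | hadd f g hf hg => rw [map_add, coeff_add, coeff_add, hf, hg, coeff_add, coeff_add]; ring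
  | hm i' j' c =>
    have : NN (monomial i' (monomial j' c)) = monomial i' (monomial j' ((-1)^(i'+j') * c)) := by
      rw [mono_eq, mono_eq, map_mul, map_mul, map_pow, map_pow, NN_uu, NN_vv, NN_CC, C_mul, C_mul, neg_pow uu, neg_pow vv]
      have e : (C (C ((-1:ℂ)^(i'+j'))) : RR) = (-1)^(i'+j') := by simp
      rw [e, pow_add]; ring
    rw [this]
    simp only [coeff_monomial]
    by_cases h1 : i' = i
    · subst h1
      simp only [if_true, coeff_monomial]
      split_ifs with h <;> simp [h]
    · simp [h1]

theorem NN_NN (f : RR) : NN (NN f) = f := by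
  ext i j
  rw [NN_coeff, NN_coeff, ← mul_assoc, ← mul_pow]; simp

theorem NN_odd {f : RR} (h : NN f = -f) {i j : ℕ} (hij : (f.coeff i).coeff j ≠ 0) : Odd (i+j) := by
  by_contra hc
  have h1 := NN_coeff f i j
  rw [h, (Nat.not_odd_iff_even.1 hc).neg_one_pow] at h1
  simp at h1
  exact hij (self_eq_neg.1 h1.symm)

open ComplexConjugate in
structure Tau (τ : RR →+* RR) : Prop where
  hC : ∀ z : ℂ, τ (C (C z)) = C (C (conj z))
  hsq : (∀ f, τ (τ f) = f) ∨ (∀ f, τ (τ f) = NN f)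
  hodd : ∀ f, τ (NN f) = NN (τ f)

theorem Tau.four {τ : RR →+* RR} (h : Tau τ) (f : RR) : τ (τ (τ (τ f))) = f := by
  rcases h.hsq with h1 | h1
  · rw [h1, h1]
  · rw [h1, h1, NN_NN]

/-- conjugated derivation -/
noncomputable def conjDer {τ : RR →+* RR} (h : Tau τ) (d : Derivation ℂ RR RR) : Derivation ℂ RR RR :=
  Derivation.mk'
    { toFun := fun f => τ (d (τ (τ (τ f))))
      map_add' := by simp
      map_smul' := by
        intro r f
        simp only [Algebra.smul_def, RingHom.id_apply]
        have : ∀ z, algebraMap ℂ RR z = C (C z) := fun _ => rfl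
        simp only [this, map_mul, h.hC, Derivation.leibniz, der_CC]
        simp [h.hC] }
    (by
      intro a b
      show τ (d (τ (τ (τ (a * b))))) = a * τ (d (τ (τ (τ b)))) + b * τ (d (τ (τ (τ a))))
      simp only [map_mul, Derivation.leibniz, smul_eq_mul, map_add, h.four])

theorem conjDer_apply {τ : RR →+* RR} (h : Tau τ) (d : Derivation ℂ RR RR) (f : RR) :
  conjDer h d f = τ (d (τ (τ (τ f)))) := rfl

theorem conjDer_tau {τ : RR →+* RR} (h : Tau τ) (d : Derivation ℂ RR RR) (f : RR) :
  conjDer h d (τ f) = τ (d f) := by rw [conjDer_apply, h.four]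

theorem Tau.LN {τ : RR →+* RR} (h : Tau τ) : LN (ham (τ vv)) := by
  set G := τ vv with hG
  set F := τ uu with hF
  have a1 : conjDer h du F = 1 := by rw [hF, conjDer_tau, du_uu, map_one]
  have a2 : conjDer h du G = 0 := by rw [hG, conjDer_tau, du_vv, map_zero]
  have b1 : conjDer h dv F = 0 := by rw [hF, conjDer_tau, dv_uu, map_zero]
  have b2 : conjDer h dv G = 1 := by rw [hG, conjDer_tau, dv_vv, map_one]
  rw [der_eq] at a1 a2 b1 b2
  set D := conjDer h du with hD
  set E := conjDer h dv
  set J := du F * dv G - dv F * du G with hJ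
  have e1 : J * D uu = dv G := by rw [hJ]; linear_combination (dv G) * a1 - (dv F) * a2
  have e2 : J * D vv = -du G := by rw [hJ]; linear_combination (du F) * a2 - (du G) * a1
  have e3 : J * E uu = -dv F := by rw [hJ]; linear_combination (dv G) * b1 - (dv F) * b2
  have e4 : J * E vv = du F := by rw [hJ]; linear_combination (du F) * b2 - (du G) * b1
  have hJ0 : J ≠ 0 := by
    intro h0
    rw [h0, zero_mul] at e1 e2
    rw [← e1, neg_eq_iff_eq_neg.1 e2.symm] at b2
    simp at b2
  have hu : J * (D uu * E vv - D vv * E uu) = 1 := by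
    apply mul_left_cancel₀ hJ0
    have : J * (J * (D uu * E vv - D vv * E uu)) = (J * D uu) * (J * E vv) - (J * D vv) * (J * E uu) := by ring
    rw [this, e1, e2, e3, e4, hJ]; ring
  have hunit : IsUnit J := IsUnit.of_mul_eq_one _ hu
  obtain ⟨g, hg, hgJ⟩ := Polynomial.isUnit_iff.1 hunit
  obtain ⟨j, hj, rfl⟩ := Polynomial.isUnit_iff.1 hg
  have hham : ∀ f, ham G f = C (C (-j)) * D f := by
    intro f
    rw [ham_apply, der_eq D f]
    have : (C (C (-j)) : RR) = -J := by rw [← hgJ]; simp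
    rw [this]
    linear_combination (du f) * e1 + (dv f) * e2
  have hit : ∀ k f, (ham G)^[k] f = C (C ((-j)^k)) * τ (du^[k] (τ (τ (τ f)))) := by
    intro k
    induction k with
    | zero => intro f; simp [h.four]
    | succ k ih =>
      intro f
      rw [Function.iterate_succ_apply', ih, hham, Derivation.leibniz, der_CC, hD, conjDer_tau,
        Function.iterate_succ_apply', pow_succ]
      simp only [C_mul, smul_eq_mul, mul_zero, add_zero]
      ring
  intro f
  refine ⟨(τ (τ (τ f))).natDegree + 1, ?_⟩
  rw [hit]
  have : du^[(τ (τ (τ f))).natDegree + 1] (τ (τ (τ f))) = 0 :=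
    iterate_derivative_eq_zero (Nat.lt_succ_self _)
  rw [this]; simp

def Concl (τ : RR →+* RR) : Prop := ∃ x y : RR, NN x = -x ∧ NN y = -y ∧
  Algebra.adjoin ℂ {x, y} = ⊤ ∧
  ((τ x = x ∧ τ y = y) ∨ (τ x = y ∧ τ y = x) ∨ (τ x = y ∧ τ y = -x))

noncomputable def conjT (τ : RR →+* RR) (ψ : RR ≃ₐ[ℂ] RR) : RR →+* RR :=
  (ψ.symm : RR →+* RR).comp (τ.comp (ψ : RR →+* RR))

theorem conjT_apply (τ : RR →+* RR) (ψ : RR ≃ₐ[ℂ] RR) (f : RR) : conjT τ ψ f = ψ.symm (τ (ψ f)) := rfl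

theorem Tau.conjT {τ : RR →+* RR} (h : Tau τ) (ψ : RR ≃ₐ[ℂ] RR) (hψ : ∀ f, ψ (NN f) = NN (ψ f)) :
    Tau (conjT τ ψ) := by
  have hψ' : ∀ f, ψ.symm (NN f) = NN (ψ.symm f) := by
    intro f; apply ψ.injective; rw [hψ]; simp
  refine ⟨?_, ?_, ?_⟩
  · intro z
    rw [conjT_apply]
    have : ∀ (φ : RR ≃ₐ[ℂ] RR) z, φ (C (C z)) = C (C z) := fun φ z => φ.commutes z
    rw [this, h.hC, this]
  · rcases h.hsq with h1 | h1
    · left; intro f; simp [conjT_apply, h1]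
    · right; intro f; simp [conjT_apply, h1, hψ']
  · intro f
    rw [conjT_apply, hψ, h.hodd, hψ', conjT_apply]

theorem Concl.of_conjT {τ : RR →+* RR} (ψ : RR ≃ₐ[ℂ] RR) (hψ : ∀ f, ψ (NN f) = NN (ψ f))
    (h : Concl (conjT τ ψ)) : Concl τ := by
  obtain ⟨x, y, hx, hy, hxy, h⟩ := h
  refine ⟨ψ x, ψ y, ?_, ?_, ?_, ?_⟩
  · rw [← hψ, hx, map_neg]
  · rw [← hψ, hy, map_neg]
  · have := congrArg (Subalgebra.map (ψ : RR →ₐ[ℂ] RR)) hxy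
    rw [AlgHom.map_adjoin] at this
    rw [Set.image_pair] at this
    rw [show ({ψ x, ψ y} : Set RR) = {(ψ : RR →ₐ[ℂ] RR) x, (ψ : RR →ₐ[ℂ] RR) y} from rfl, this,
      Algebra.map_top, AlgHom.range_eq_top]
    exact ψ.surjective
  · simp only [conjT_apply, AlgEquiv.symm_apply_eq, map_neg] at h
    exact h

theorem lam_tau_le {τ : RR →+* RR} (h : Tau τ) (k n : ℕ) (hkn : n ≤ k)
    (hF : (lam 1 1 (τ uu)).natDegree ≤ k) (hG : (lam 1 1 (τ vv)).natDegree ≤ n) (H : RR) (e : ℕ)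
    (hH : ∀ i j, (H.coeff i).coeff j ≠ 0 → i + j ≤ e) : (lam 1 1 (τ H)).natDegree ≤ k * e := by
  rw [H.as_sum_support, map_sum, map_sum]
  apply natDegree_sum_le_of_forall_le
  intro i _
  rw [(H.coeff i).as_sum_support, map_sum, map_sum, map_sum]
  apply natDegree_sum_le_of_forall_le
  intro j hj
  have hij := hH i j (by simpa using hj)
  rw [mono_eq]
  simp only [map_mul, map_pow, h.hC, lam_CC]
  have h1 := natDegree_pow_le_of_le j hG
  have h2 := natDegree_pow_le_of_le i hF
  have h3 : ∀ z : ℂ, (C (C (C z)) * lam 1 1 (τ vv) ^ j * lam 1 1 (τ uu)^i).natDegree ≤ 0 + j * n + i * k :=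
    fun z => natDegree_mul_le_of_le (natDegree_mul_le_of_le (by simp) h1) h2
  refine (h3 _).trans ?_
  nlinarith

theorem S5 {τ : RR →+* RR} (h : Tau τ) (n : ℕ) (hn : 2 ≤ n) (hd : (τ vv).natDegree = n) (c : ℂ) (hc : c ≠ 0)
    (h0 : (τ vv).coeff n = C c)
    (h1 : ∀ i j, i < n → ((τ vv).coeff i).coeff j ≠ 0 → i + j < n) (i j : ℕ)
    (hij : ((τ uu).coeff i).coeff j ≠ 0) : i + j < n := by
  by_contra hcon
  set G := τ vv with hG
  set F := τ uu with hF
  set k := (lam 1 1 F).natDegree with hk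
  have hkn : n ≤ k := by
    have := (lam_natDegree_le 1 1 F k).1 le_rfl i j hij
    omega
  have hGn : (lam 1 1 G).natDegree ≤ n := by
    rw [lam_natDegree_le]
    intro i j hij
    have hin : i ≤ n := by
      rw [← hd]; apply le_natDegree_of_ne_zero; rintro h; simp [h] at hij
    rcases Nat.lt_or_eq_of_le hin with h | h
    · have := h1 i j h hij; omega
    · subst h
      rw [h0, coeff_C] at hij
      have : j = 0 := by by_contra h; simp [h] at hij
      omega
  have hH := lam_tau_le h k n hkn le_rfl hGn G.eraseLead (n-1) (by
    intro i j hij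
    rw [eraseLead_coeff] at hij
    split_ifs at hij with hh
    · simp at hij
    · have hin : i ≤ n := by
        rw [← hd]; apply le_natDegree_of_ne_zero; rintro h; simp [h] at hij
      have := h1 i j (by omega) hij
      omega)
  have hsum : G = G.eraseLead + C (C c) * uu^n := by
    conv_lhs => rw [← eraseLead_add_C_mul_X_pow G]
    rw [leadingCoeff, hd, h0]; rfl
  have hlead : (lam 1 1 (τ (C (C c) * uu^n))).natDegree = n * k := by
    rw [map_mul, map_pow, h.hC, map_mul, map_pow, lam_CC, natDegree_C_mul, natDegree_pow]
    simpa using hc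
  have hlt : k * (n-1) < n * k := by
    rw [mul_comm]; exact Nat.mul_lt_mul_of_pos_right (by omega) (by omega)
  have hfull : (lam 1 1 (τ G)).natDegree = n * k := by
    rw [hsum, map_add, map_add, natDegree_add_eq_right_of_natDegree_lt, hlead]
    rw [hlead]; omega
  have hle : (lam 1 1 (τ G)).natDegree ≤ 1 := by
    have : τ G = vv ∨ τ G = -vv := by
      rcases h.hsq with h | h
      · left; exact h _
      · right; rw [hG, h, NN_vv]
    have h2 : (lam 1 1 vv).natDegree ≤ 1 := by rw [lam_vv]; exact natDegree_C_mul_X_pow_le _ _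
    rcases this with h | h
    · rw [h]; exact h2
    · rw [h, map_neg, natDegree_neg]; exact h2
  have : 2 * 2 ≤ n * k := Nat.mul_le_mul hn (by omega)
  omega
end

section
open Polynomial

theorem adj_lemma (S : Subalgebra ℂ RR) (β' β : ℂ) (hβ' : β' ≠ 0) (hβ : β ≠ 0) (f : ℂ[X])
    (hy : C (C β') * vv ∈ S) (hx : C (C β) * uu + C f ∈ S) : S = ⊤ := by
  have hCC : ∀ z : ℂ, (C (C z) : RR) ∈ S := fun z => S.algebraMap_mem z
  have hv : vv ∈ S := by
    have := S.mul_mem (hCC β'⁻¹) hy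
    rwa [← mul_assoc, ← C_mul, ← C_mul, inv_mul_cancel₀ hβ', C_1, C_1, one_mul] at this
  have hf : ∀ f : ℂ[X], (C f : RR) ∈ S := by
    intro f
    induction f using Polynomial.induction_on' with
    | add p q hp hq => rw [C_add]; exact S.add_mem hp hq
    | monomial n a =>
      rw [← C_mul_X_pow_eq_monomial, C_mul, C_pow]
      exact S.mul_mem (hCC a) (S.pow_mem hv n)
  have hu : uu ∈ S := by
    have := S.mul_mem (hCC β⁻¹) (S.sub_mem hx (hf f))
    rwa [add_sub_cancel_right, ← mul_assoc, ← C_mul, ← C_mul, inv_mul_cancel₀ hβ, C_1, C_1, one_mul] at this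
  rw [eq_top_iff, ← adjoin_uv, Algebra.adjoin_le_iff]
  rintro x (rfl | rfl)
  · exact hu
  · exact hv

theorem Tau.inj {τ : RR →+* RR} (h : Tau τ) : Function.Injective τ := by
  intro a b hab
  rw [← h.four a, ← h.four b, hab]

open ComplexConjugate in
theorem exists_l (c : ℂ) : ∃ l : ℂ, l + conj l * c ≠ 0 := by
  by_contra! hh
  have h1 := hh 1
  have h2 := hh Complex.I
  simp only [map_one, one_mul, Complex.conj_I] at h1 h2
  have : (2 : ℂ) * Complex.I = 0 := by linear_combination h2 + Complex.I * h1
  simp at this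

open ComplexConjugate in
theorem lin0 {τ : RR →+* RR} (h : Tau τ) (hn : (τ vv).natDegree = 0) : Concl τ := by
  obtain ⟨g, hg⟩ : ∃ g, τ vv = C g := ⟨_, eq_C_of_natDegree_eq_zero hn⟩
  let κ : ℂ[X] →+* ℂ[X] := eval₂RingHom ((C : ℂ →+* ℂ[X]).comp (starRingEnd ℂ)) g
  have hκ : ∀ f, τ (C f) = C (κ f) := by
    intro f
    have : τ.comp (C : ℂ[X] →+* RR) = (C : ℂ[X] →+* RR).comp κ := by
      apply Polynomial.ringHom_ext'
      · ext z; simp [κ, h.hC]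
      · simpa [κ, vv] using hg
    exact congrArg (fun φ => φ f) this
  have hκd : ∀ f, (κ f).natDegree = f.natDegree * g.natDegree := by
    intro f
    have : κ f = (f.map (starRingEnd ℂ)).comp g := by
      simp only [κ, coe_eval₂RingHom, comp, eval₂_map]
    rw [this, natDegree_comp, natDegree_map_eq_of_injective (starRingEnd ℂ).injective]
  have hκinj : Function.Injective κ := by
    intro a b hab
    have : τ (C a) = τ (C b) := by rw [hκ, hκ, hab]
    exact C_injective (h.inj this)
  have hsq : κ g = X ∨ κ g = -X := by
    have e : τ (τ vv) = C (κ g) := by rw [hg, hκ]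
    rcases h.hsq with h1 | h1
    · left; rw [h1] at e; exact C_injective e.symm
    · right; rw [h1, NN_vv] at e; apply C_injective; rw [← e, vv, C_neg]
  have hgd : g.natDegree = 1 := by
    have : (κ g).natDegree = 1 := by rcases hsq with h | h <;> rw [h] <;> simp
    rw [hκd] at this
    exact Nat.eq_one_of_mul_eq_one_left this
  obtain ⟨a, b, hab⟩ := exists_eq_X_add_C_of_natDegree_le_one hgd.le
  have hb : b = 0 := by
    by_contra hb
    have : NN (τ vv) = - τ vv := by rw [← h.hodd, NN_vv, map_neg]
    have := NN_odd (i := 0) (j := 0) this (by rw [hg, hab]; simpa using hb)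
    simp at this
  subst hb
  rw [C_0, add_zero] at hab
  have hκg : κ g = C (conj a * a) * X := by
    conv_lhs => rw [hab]
    rw [map_mul]
    simp only [κ, coe_eval₂RingHom, eval₂_C, eval₂_X, RingHom.comp_apply]
    rw [hab, C_mul]; ring
  have hsq1 : ∀ f, τ (τ f) = f := by
    rcases h.hsq with h1 | h1
    · exact h1
    · exfalso
      have e : τ (τ vv) = C (κ g) := by rw [hg, hκ]
      rw [h1, NN_vv, hκg, vv, ← C_neg] at e
      have e2 := congrArg (fun p => p.coeff 1) (C_injective e)
      simp at e2
      rw [mul_comm, Complex.mul_conj] at e2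
      have := congrArg Complex.re e2
      simp at this
      have h3 := Complex.normSq_nonneg a
      linarith
  set F := τ uu with hF
  have hτ : ∀ f : RR, τ f = (f.map κ).comp F := by
    intro f
    have : τ = (eval₂RingHom ((C : ℂ[X] →+* RR).comp κ) F) := by
      apply Polynomial.ringHom_ext'
      · apply RingHom.ext; intro z
        simp [← hκ]
      · simp [hF, uu]
    conv_lhs => rw [this]
    simp only [coe_eval₂RingHom, comp, eval₂_map]
  have hFd : F.natDegree = 1 := by
    have e : (τ F).natDegree = 1 := by rw [hF, hsq1, uu]; simp
    rw [hτ, natDegree_comp, natDegree_map_eq_of_injective hκinj] at e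
    exact Nat.eq_one_of_mul_eq_one_left e
  obtain ⟨c1, c0, hc⟩ := exists_eq_X_add_C_of_natDegree_le_one hFd.le
  have hunit : κ c1 * c1 = 1 := by
    have e : τ F = X := by rw [hF, hsq1, uu]
    rw [hτ] at e
    conv_lhs at e => rw [hc]
    simp only [Polynomial.map_add, Polynomial.map_mul, map_C, map_X, add_comp, mul_comp, C_comp, X_comp] at e
    have := congrArg (fun p => p.coeff 1) e
    simpa [coeff_C, coeff_add] using this
  obtain ⟨c, hcu, rfl⟩ := Polynomial.isUnit_iff.1 (IsUnit.of_mul_eq_one_right _ hunit)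
  obtain ⟨k, hk⟩ := exists_l a
  obtain ⟨l, hl⟩ := exists_l c
  have ey : C (C k) * vv + τ (C (C k) * vv) = C (C (k + conj k * a)) * vv := by
    rw [map_mul, h.hC, hg, hab]; simp only [vv, C_add, C_mul]; ring
  have ex : C (C l) * uu + τ (C (C l) * uu) = C (C (l + conj l * c)) * uu + C (C (conj l) * c0) := by
    rw [map_mul, h.hC, ← hF, hc]; simp only [uu, C_add, C_mul]; ring
  refine ⟨C (C l) * uu + τ (C (C l) * uu), C (C k) * vv + τ (C (C k) * vv), ?_, ?_, ?_, Or.inl ⟨?_, ?_⟩⟩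
  · rw [map_add, ← h.hodd, map_mul, NN_CC, NN_uu]; simp only [map_mul, map_neg]; ring
  · rw [map_add, ← h.hodd, map_mul, NN_CC, NN_vv]; simp only [map_mul, map_neg]; ring
  · apply adj_lemma _ _ _ hk hl (C (conj l) * c0)
    · rw [← ey]; apply Algebra.subset_adjoin; simp
    · rw [← ex]; apply Algebra.subset_adjoin; simp
  · rw [map_add, hsq1, add_comm]
  · rw [map_add, hsq1, add_comm]

theorem lin1 {τ : RR →+* RR} (h : Tau τ) (hn : (τ vv).natDegree = 1) : Concl τ := by
  obtain ⟨c, hc, hc1⟩ := S1 _ h.LN hn.ge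
  obtain ⟨a, b, hab⟩ := exists_eq_X_add_C_of_natDegree_le_one hn.le
  have : a = C c := by
    rw [hn, hab] at hc1; simpa [coeff_C] using hc1
  subst this
  have hv : NN vv = -vv := NN_vv
  have hv' : NN (τ vv) = - τ vv := by rw [← h.hodd, NN_vv, map_neg]
  have had : ∀ S : Subalgebra ℂ RR, vv ∈ S → τ vv ∈ S → S = ⊤ := by
    intro S h1 h2
    apply adj_lemma S 1 c one_ne_zero hc b
    · simpa using h1
    · rw [hab] at h2; exact h2
  rcases h.hsq with h1 | h1
  · refine ⟨vv, τ vv, hv, hv', ?_, Or.inr (Or.inl ⟨rfl, h1 _⟩)⟩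
    apply had <;> apply Algebra.subset_adjoin <;> simp
  · refine ⟨vv, τ vv, hv, hv', ?_, Or.inr (Or.inr ⟨rfl, by rw [h1, NN_vv]⟩)⟩
    apply had <;> apply Algebra.subset_adjoin <;> simp

theorem comm_NN (ψ : RR ≃ₐ[ℂ] RR) (hu : ψ (NN uu) = NN (ψ uu)) (hv : ψ (NN vv) = NN (ψ vv)) :
    ∀ f, ψ (NN f) = NN (ψ f) := by
  intro f
  have : ((ψ : RR →ₐ[ℂ] RR).comp NN : RR →+* RR) = (NN.comp (ψ : RR →ₐ[ℂ] RR) : RR →+* RR) := by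
    apply RR_hom_ext
    · intro z
      exact (((ψ : RR →ₐ[ℂ] RR).comp NN).commutes z).trans ((NN.comp (ψ : RR →ₐ[ℂ] RR)).commutes z).symm
    · exact hu
    · exact hv
  exact congrArg (fun φ => φ f) this

theorem taylor_sub (β : ℂ[X]) (G : RR) (n : ℕ) (hn : 1 ≤ n) (hd : G.natDegree = n) :
    (taylor β G).coeff (n-1) = G.coeff (n-1) + (n : ℂ[X]) * G.coeff n * β := by
  rw [taylor_coeff]
  have h1 : (hasseDeriv (n-1) G).natDegree ≤ 1 := by
    refine (natDegree_hasseDeriv_le _ _).trans ?_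
    omega
  rw [eq_X_add_C_of_natDegree_le_one h1]
  simp only [eval_add, eval_mul, eval_C, eval_X, hasseDeriv_coeff]
  have e : 1 + (n-1) = n := by omega
  have e' : n.choose (n-1) = n := by
    obtain ⟨m, rfl⟩ : ∃ m, n = m+1 := ⟨n-1, by omega⟩
    simp
  rw [e, e']
  simp; ring

theorem swap_coeff (f : RR) (i j : ℕ) : ((Bivariate.swap f).coeff i).coeff j = (f.coeff j).coeff i := by
  induction f using RR_induction with
  | hadd f g hf hg => simp only [map_add, coeff_add, hf, hg]
  | hm i' j' c =>
    rw [Bivariate.swap_monomial_monomial]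
    simp only [coeff_monomial]
    by_cases h1 : i' = j <;> by_cases h2 : j' = i <;> simp [h1, h2, coeff_monomial]

theorem linearize : ∀ (n : ℕ) (τ : RR →+* RR), Tau τ → (τ vv).natDegree = n → Concl τ := by
  intro n
  induction n using Nat.strong_induction_on with
  | _ n IH =>
  intro τ h hn
  rcases Nat.lt_or_ge n 2 with h2 | h2
  · interval_cases n
    · exact lin0 h hn
    · exact lin1 h hn
  obtain ⟨c, hc, hc1⟩ := S1 _ h.LN (by omega)
  rw [hn] at hc1
  have hGodd : NN (τ vv) = - τ vv := by rw [← h.hodd, NN_vv, map_neg]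
  have hnodd : Odd n := by
    have := NN_odd hGodd (i := n) (j := 0) (by rw [hc1]; simpa using hc)
    simpa using this
  set β : ℂ[X] := C (-(1/(n*c))) * (τ vv).coeff (n-1) with hβ
  have hn0 : (n : ℂ) ≠ 0 := by exact_mod_cast (by omega : n ≠ 0)
  have hβodd : NN (C β) = - C β := by
    ext i j
    rw [NN_coeff]
    rcases Nat.eq_zero_or_pos i with rfl | hi
    · simp only [coeff_neg, coeff_C_zero, zero_add, hβ, coeff_C_mul]
      by_cases h0 : ((τ vv).coeff (n-1)).coeff j = 0
      · simp [h0]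
      · have h1 := NN_odd hGodd h0
        have : Odd j := by
          obtain ⟨a, ha⟩ := hnodd
          obtain ⟨b, hb⟩ := h1
          refine ⟨b - a, by omega⟩
        rw [this.neg_one_pow]; ring
    · simp [coeff_C, hi.ne']
  let ψ : RR ≃ₐ[ℂ] RR := ((taylorEquiv β).symm).restrictScalars ℂ
  have hψs : ∀ f, ψ.symm f = taylor β f := fun f => rfl
  have hψ' : ∀ f, ψ f = taylor (-β) f := by
    intro f
    apply ψ.symm.injective
    rw [hψs (taylor (-β) f), taylor_taylor]; simp
  have hψN : ∀ f, ψ (NN f) = NN (ψ f) := by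
    apply comm_NN
    · rw [NN_uu, map_neg, hψ', uu, taylor_X, map_add, C_neg, map_neg, hβodd]
      rw [show NN X = -X from NN_uu]; ring
    · rw [NN_vv, map_neg, hψ', vv, taylor_C, show NN (C X : RR) = -(C X : RR) from NN_vv]
  have hT := h.conjT ψ hψN
  refine Concl.of_conjT ψ hψN ?_
  set τ' := conjT τ ψ with hτ'
  have hv' : τ' vv = taylor β (τ vv) := by
    rw [hτ', conjT_apply, hψs, hψ', vv, taylor_C]
  have hd' : (τ' vv).natDegree = n := by rw [hv', natDegree_taylor, hn]
  have hcn' : (τ' vv).coeff n = C c := by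
    rw [hv', ← hc1]
    have := leadingCoeff_taylor (r := β) (f := τ vv)
    rwa [leadingCoeff, leadingCoeff, natDegree_taylor, hn] at this
  have hcn1 : (τ' vv).coeff (n-1) = 0 := by
    rw [hv', taylor_sub β _ n (by omega) hn, hc1, hβ]
    have : (n : ℂ[X]) * C c * (C (-(1/(n*c))) * (τ vv).coeff (n-1)) = C (n * c * (-(1/(n*c)))) * (τ vv).coeff (n-1) := by
      simp only [C_mul, map_natCast]; ring
    rw [this]
    have : (n * c * (-(1/(n*c))) : ℂ) = -1 := by field_simp
    rw [this]; simp
  have h3 := fun i j hi hij => S3 _ hT.LN n h2 hd' c hc hcn' hcn1 i j hi hij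
  have h5 := S5 hT n h2 hd' c hc hcn' h3
  have hsN : ∀ f, (Bivariate.swap : RR ≃ₐ[ℂ] RR) (NN f) = NN ((Bivariate.swap : RR ≃ₐ[ℂ] RR) f) := by
    intro f
    ext i j
    rw [swap_coeff, NN_coeff, NN_coeff, swap_coeff, add_comm]
  refine Concl.of_conjT Bivariate.swap hsN ?_
  refine IH _ ?_ _ (hT.conjT _ hsN) rfl
  have e : conjT τ' Bivariate.swap vv = Bivariate.swap (τ' uu) := by
    rw [conjT_apply, Bivariate.swap_symm, vv, Bivariate.swap_X]; rfl
  rw [e]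
  have : (Bivariate.swap (τ' uu)).natDegree ≤ n - 1 := by
    rw [natDegree_le_iff_coeff_eq_zero]
    intro N hN
    ext j
    rw [swap_coeff, coeff_zero]
    by_contra h0
    have := h5 _ _ h0
    omega
  omega
end

section
open Polynomial

theorem npe {A : Type*} [CommRing A] {n : ℕ} (h : Even n) : (-1 : A)^n = 1 := h.neg_one_pow
theorem npo {A : Type*} [CommRing A] {n : ℕ} (h : Odd n) : (-1 : A)^n = -1 := h.neg_one_pow

abbrev BB := MvPolynomial (Fin 3) ℂ ⧸
  Ideal.span {(MvPolynomial.X 0 * MvPolynomial.X 1 : MvPolynomial (Fin 3) ℂ) - MvPolynomial.X 2 ^ 2}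

noncomputable def bx : BB := Ideal.Quotient.mk _ (MvPolynomial.X 0)
noncomputable def by' : BB := Ideal.Quotient.mk _ (MvPolynomial.X 1)
noncomputable def bz : BB := Ideal.Quotient.mk _ (MvPolynomial.X 2)

theorem bxy : bx * by' = bz ^ 2 := by
  rw [bx, by', bz, ← map_mul, ← map_pow, Ideal.Quotient.eq]
  exact Ideal.subset_span rfl

theorem BB_hom_ext {A : Type*} [CommRing A] {f g : BB →+* A}
    (hC : ∀ z, f (algebraMap ℂ BB z) = g (algebraMap ℂ BB z))
    (hx : f bx = g bx) (hy : f by' = g by') (hz : f bz = g bz) : f = g := by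
  apply Ideal.Quotient.ringHom_ext
  apply MvPolynomial.ringHom_ext
  · intro z; exact hC z
  · intro i; fin_cases i
    · exact hx
    · exact hy
    · exact hz

/-- universal property -/
noncomputable def BBlift {A : Type*} [CommRing A] [Algebra ℂ A] (x y z : A) (h : x * y = z^2) : BB →ₐ[ℂ] A :=
  Ideal.Quotient.liftₐ _ (MvPolynomial.aeval ![x,y,z]) (by
    intro a ha
    have : Ideal.span {(MvPolynomial.X 0 * MvPolynomial.X 1 : MvPolynomial (Fin 3) ℂ) - MvPolynomial.X 2 ^ 2} ≤
      RingHom.ker (MvPolynomial.aeval (R := ℂ) ![x,y,z]) := by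
      rw [Ideal.span_le]
      rintro _ rfl
      simp [RingHom.mem_ker, h]
    exact this ha)

section
variable {A : Type*} [CommRing A] [Algebra ℂ A] (x y z : A) (h : x * y = z^2)
theorem BBlift_x : BBlift x y z h bx = x := by
  show MvPolynomial.aeval _ _ = _
  simp
theorem BBlift_y : BBlift x y z h by' = y := by
  show MvPolynomial.aeval _ _ = _
  simp
theorem BBlift_z : BBlift x y z h bz = z := by
  show MvPolynomial.aeval _ _ = _
  simp
end

noncomputable def ii : BB →ₐ[ℂ] RR := BBlift (uu^2) (vv^2) (uu*vv) (by ring)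
theorem ii_x : ii bx = uu^2 := BBlift_x _ _ _ _
theorem ii_y : ii by' = vv^2 := BBlift_y _ _ _ _
theorem ii_z : ii bz = uu*vv := BBlift_z _ _ _ _
theorem ii_C (z : ℂ) : ii (algebraMap ℂ BB z) = C (C z) := ii.commutes z

noncomputable def LL : RR →ₗ[ℂ] BB :=
  lsum (fun i => lsum (fun j => LinearMap.toSpanSingleton ℂ BB (bx^(i/2)*by'^(j/2)*bz^((i%2)*(j%2)))))

theorem LL_ii (b : BB) : LL (ii b) = b := by
  have : (LL ∘ₗ ii.toLinearMap) ∘ₗ (Ideal.Quotient.mkₐ ℂ _).toLinearMap = (Ideal.Quotient.mkₐ ℂ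
      (Ideal.span {(MvPolynomial.X 0 * MvPolynomial.X 1 : MvPolynomial (Fin 3) ℂ) - MvPolynomial.X 2 ^ 2})).toLinearMap := by
    ext s
    simp only [LinearMap.comp_apply, AlgHom.toLinearMap_apply]
    have e : Ideal.Quotient.mkₐ ℂ (Ideal.span {(MvPolynomial.X 0 * MvPolynomial.X 1 : MvPolynomial (Fin 3) ℂ) - MvPolynomial.X 2 ^ 2})
        (MvPolynomial.monomial s 1) = bx ^ s 0 * by' ^ s 1 * bz ^ s 2 := by
      rw [MvPolynomial.monomial_eq, Finsupp.prod_fintype _ _ (by simp), Fin.prod_univ_three]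
      simp [bx, by', bz]
    have e0 : ((AddMonoidAlgebra.lsingle s : ℂ →ₗ[ℂ] MvPolynomial (Fin 3) ℂ) 1) = MvPolynomial.monomial s 1 := rfl
    rw [e0, e]
    have e2 : ii (bx ^ s 0 * by' ^ s 1 * bz ^ s 2) = monomial (2 * s 0 + s 2) (monomial (2 * s 1 + s 2) 1) := by
      rw [mono_eq]
      simp only [map_mul, map_pow, ii_x, ii_y, ii_z, C_1]
      ring
    rw [e2, LL, lsum_apply, sum_monomial_index _ _ (by simp), lsum_apply, sum_monomial_index _ _ (by simp)]
    simp only [LinearMap.toSpanSingleton_apply, one_smul]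
    have h1 : (2 * s 0 + s 2) / 2 = s 0 + s 2 / 2 := by omega
    have h2 : (2 * s 1 + s 2) / 2 = s 1 + s 2 / 2 := by omega
    have h3 : (2 * s 0 + s 2) % 2 * ((2 * s 1 + s 2) % 2) = s 2 % 2 := by
      rcases Nat.mod_two_eq_zero_or_one (s 2) with h | h <;> simp [Nat.add_mod, h]
    rw [h1, h2, h3, pow_add, pow_add]
    have h4 : bz ^ s 2 = (bz^2)^(s 2 / 2) * bz ^ (s 2 % 2) := by
      rw [← pow_mul, ← pow_add, Nat.div_add_mod]
    rw [h4, ← bxy]; ring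
  obtain ⟨p, rfl⟩ := Ideal.Quotient.mk_surjective b
  exact congrArg (fun φ => φ p) this

theorem ii_inj : Function.Injective ii := Function.LeftInverse.injective LL_ii

theorem NN_ii (b : BB) : NN (ii b) = ii b := by
  have : (NN.comp ii : BB →+* RR) = (ii : BB →+* RR) := by
    apply BB_hom_ext
    · intro z; exact (NN.comp ii).commutes z |>.trans (ii.commutes z).symm
    · simp [ii_x, NN_uu]; ring
    · simp [ii_y, NN_vv]; ring
    · simp [ii_z, NN_uu, NN_vv]; ring
  exact congrArg (fun φ => φ b) this

theorem add_NN_mem (f : RR) : f + NN f ∈ ii.range := by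
  induction f using RR_induction with
  | hadd f g hf hg =>
    have := add_mem hf hg
    rw [map_add]
    convert this using 1; ring
  | hm i j c =>
    have e : NN (C (C c) * vv^j * uu^i) = (-1)^(i+j) * (C (C c) * vv^j * uu^i) := by
      rw [map_mul, map_mul, map_pow, map_pow, NN_uu, NN_vv, NN_CC, neg_pow uu, neg_pow vv, pow_add]; ring
    rw [mono_eq, e]
    rcases Nat.even_or_odd (i+j) with h | h
    · have hh : (-1 : RR)^(i+j) = 1 := npe h
      rw [hh, one_mul]
      have hm : C (C c) * vv^j * uu^i ∈ ii.range := by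
        refine ⟨algebraMap ℂ BB c * bx^(i/2) * by'^(j/2) * bz^(i%2), ?_⟩
        show ii _ = _
        simp only [map_mul, map_pow, ii_x, ii_y, ii_z, ii_C]
        have hij : i % 2 = j % 2 := by obtain ⟨k, hk⟩ := h; omega
        conv_rhs => rw [← Nat.div_add_mod i 2, ← Nat.div_add_mod j 2, ← hij]
        ring
      exact add_mem hm hm
    · have hh : (-1 : RR)^(i+j) = -1 := npo h
      have h0 : C (C c) * vv ^ j * uu ^ i + -1 * (C (C c) * vv ^ j * uu ^ i) = 0 := by ring
      rw [hh, h0]; exact zero_mem _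

theorem even_mem {f : RR} (h : NN f = f) : ∃ b, ii b = f := by
  have h1 := add_NN_mem f
  rw [h] at h1
  have h2 := ii.range.smul_mem h1 (1/2 : ℂ)
  rw [← two_smul ℂ f, smul_smul] at h2
  norm_num at h2
  exact h2
end

section
open Polynomial

theorem noeth_inj {A : Type*} [CommRing A] [IsNoetherianRing A] (φ : A →+* A) (h : Function.Surjective φ) :
    Function.Injective φ := by
  have hs : ∀ n, φ^[n+1] = φ ∘ φ^[n] := fun n => Function.iterate_succ' _ _
  let K : ℕ →o Ideal A := ⟨fun n => RingHom.ker (φ^n), by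
    apply monotone_nat_of_le_succ
    intro n x hx
    rw [RingHom.mem_ker, RingHom.coe_pow] at hx ⊢
    rw [hs, Function.comp_apply, hx, map_zero]⟩
  obtain ⟨n, hn⟩ := monotone_stabilizes_iff_noetherian.2 ‹IsNoetherianRing A› K
  rw [injective_iff_map_eq_zero]
  intro a ha
  obtain ⟨b, rfl⟩ := h.iterate n a
  have h1 : b ∈ K (n+1) := by
    show b ∈ RingHom.ker _
    rw [RingHom.mem_ker, RingHom.coe_pow, hs]; exact ha
  rw [← hn (n+1) (by omega)] at h1
  have h2 : b ∈ RingHom.ker (φ^n) := h1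
  rwa [RingHom.mem_ker, RingHom.coe_pow] at h2

open ComplexConjugate in
structure Sig (σ : BB →+* BB) : Prop where
  hC : ∀ z : ℂ, σ (algebraMap ℂ BB z) = algebraMap ℂ BB (conj z)
  hsq : ∀ b, σ (σ b) = b

theorem Sig.inj {σ : BB →+* BB} (h : Sig σ) : Function.Injective σ :=
  Function.LeftInverse.injective h.hsq

theorem uu_ne : uu ≠ 0 := X_ne_zero
theorem vv_ne : vv ≠ 0 := by rw [vv]; simp

open ComplexConjugate in
theorem Sig.noprime {σ : BB →+* BB} (h : Sig σ) (p : RR) (hx : p ∣ ii (σ bx)) (hy : p ∣ ii (σ by'))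
    (hz : p ∣ ii (σ bz)) : IsUnit p := by
  have key : ∀ b, ∃ α : ℂ, p ∣ ii (σ b) - C (C α) := by
    intro b
    obtain ⟨P, rfl⟩ := Ideal.Quotient.mk_surjective b
    induction P using MvPolynomial.induction_on with
    | C a =>
      refine ⟨conj a, ?_⟩
      have : ii (σ (algebraMap ℂ BB a)) = C (C (conj a)) := by rw [h.hC, ii_C]
      rw [show (Ideal.Quotient.mk _ (MvPolynomial.C a) : BB) = algebraMap ℂ BB a from rfl, this, sub_self]
      exact dvd_zero _
    | add P Q hP hQ =>
      obtain ⟨α, hα⟩ := hP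
      obtain ⟨β, hβ⟩ := hQ
      refine ⟨α + β, ?_⟩
      have := dvd_add hα hβ
      simp only [map_add]
      convert this using 1; ring
    | mul_X P i _ =>
      refine ⟨0, ?_⟩
      simp only [map_mul, map_zero, sub_zero]
      apply Dvd.dvd.mul_left
      fin_cases i
      · exact hx
      · exact hy
      · exact hz
  obtain ⟨α, hα⟩ := key (σ bx)
  obtain ⟨β, hβ⟩ := key (σ by')
  rw [h.hsq, ii_x] at hα
  rw [h.hsq, ii_y] at hβ
  have e : vv^2 - C (C β) = C (X^2 - C β) := by simp [vv]
  rw [e] at hβ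
  have hne : (X^2 - C β : ℂ[X]) ≠ 0 := X_pow_sub_C_ne_zero (by norm_num) β
  have hd : p.natDegree = 0 := by
    have := natDegree_le_of_dvd hβ (by rw [Ne, C_eq_zero]; exact hne)
    simpa using this
  rw [eq_C_of_natDegree_eq_zero hd] at hα ⊢
  rw [C_dvd_iff_dvd_coeff] at hα
  have := hα 2
  rw [uu, coeff_sub, coeff_X_pow, coeff_C] at this
  have h1 : IsUnit (p.coeff 0) := isUnit_of_dvd_one (by simpa using this)
  exact h1.map C

theorem unit_sqrt (w : RRˣ) : ∃ s : RR, s^2 = w := by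
  obtain ⟨g, hg, h1⟩ := Polynomial.isUnit_iff.1 w.isUnit
  obtain ⟨j, hj, rfl⟩ := Polynomial.isUnit_iff.1 hg
  obtain ⟨s, hs⟩ := IsAlgClosed.exists_pow_nat_eq j (n := 2) (by norm_num)
  exact ⟨C (C s), by rw [← h1, ← hs]; simp⟩

theorem sq_of_coprime (a b d : RR) (h : a * b = d^2) (hc : IsRelPrime a b) : ∃ f, f^2 = a := by
  let _ : GCDMonoid RR := UniqueFactorizationMonoid.toGCDMonoid RR
  obtain ⟨f, w, hw⟩ := exists_associated_pow_of_mul_eq_pow (gcd_isUnit_iff_isRelPrime.2 hc) h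
  obtain ⟨s, hs⟩ := unit_sqrt w
  exact ⟨f * s, by rw [mul_pow, hs, hw]⟩

theorem even_or_odd_of_sq {f : RR} {b : BB} (h : f^2 = ii b) : NN f = f ∨ NN f = -f := by
  have : (NN f)^2 = f^2 := by rw [← map_pow, h, NN_ii]
  exact sq_eq_sq_iff_eq_or_eq_neg.1 this

theorem Sig.odd {σ : BB →+* BB} (h : Sig σ) (b : BB) (w : RR) (hw : NN w = -w) (hw0 : w ≠ 0) (hb : ii b = w^2)
    (f : RR) (hf : f^2 = ii (σ b)) : NN f = -f := by
  rcases even_or_odd_of_sq hf with h1 | h1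
  · exfalso
    obtain ⟨t, ht⟩ := even_mem h1
    rw [← ht, ← map_pow] at hf
    have h2 := ii_inj hf
    have h3 : (ii (σ t))^2 = w^2 := by
      rw [← map_pow, ← map_pow, h2, h.hsq, hb]
    have h4 := NN_ii (σ t)
    rcases sq_eq_sq_iff_eq_or_eq_neg.1 h3 with h5 | h5
    · rw [h5, hw] at h4; exact hw0 (self_eq_neg.1 h4.symm)
    · rw [h5, map_neg, hw, neg_neg] at h4; exact hw0 (self_eq_neg.1 h4)
  · exact h1

theorem Sig.lift {σ : BB →+* BB} (h : Sig σ) : ∃ τ : RR →+* RR, Tau τ ∧ ∀ b, τ (ii b) = ii (σ b) := by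
  have hmul : ii (σ bx) * ii (σ by') = (ii (σ bz))^2 := by
    rw [← map_mul, ← map_mul, bxy, map_pow, map_pow]
  have hrel : IsRelPrime (ii (σ bx)) (ii (σ by')) := by
    apply isRelPrime_of_no_nonunits_factors
    · rintro ⟨h1, -⟩
      have h2 : ii (σ bx) = ii (σ 0) := by rw [h1, map_zero, map_zero]
      have h3 := congrArg ii (h.inj (ii_inj h2))
      rw [ii_x, map_zero] at h3
      exact uu_ne (pow_eq_zero_iff (by norm_num) |>.1 h3)
    · intro z hz hz0 h1 h2
      obtain ⟨p, hp, hpz⟩ := WfDvdMonoid.exists_irreducible_factor hz hz0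
      have hp' := hp.prime
      have h3 : p ∣ (ii (σ bz))^2 := by rw [← hmul]; exact Dvd.dvd.mul_right (hpz.trans h1) _
      exact hp.not_isUnit (h.noprime p (hpz.trans h1) (hpz.trans h2) (hp'.dvd_of_dvd_pow h3))
  obtain ⟨f, hf⟩ := sq_of_coprime _ _ _ hmul hrel
  obtain ⟨g, hg, hfg⟩ : ∃ g, g^2 = ii (σ by') ∧ f * g = ii (σ bz) := by
    obtain ⟨g, hg⟩ := sq_of_coprime _ _ _ (by rw [mul_comm]; exact hmul) hrel.symm
    have : (f * g)^2 = (ii (σ bz))^2 := by rw [mul_pow, hf, hg, hmul]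
    rcases sq_eq_sq_iff_eq_or_eq_neg.1 this with h1 | h1
    · exact ⟨g, hg, h1⟩
    · exact ⟨-g, by rw [← hg]; ring, by linear_combination -h1⟩
  have hfo : NN f = -f := h.odd bx uu NN_uu uu_ne ii_x f hf
  have hgo : NN g = -g := h.odd by' vv NN_vv vv_ne ii_y g hg
  let τ : RR →+* RR := eval₂RingHom (eval₂RingHom (((C : ℂ[X] →+* RR).comp C).comp (starRingEnd ℂ)) g) f
  have τu : τ uu = f := by simp [τ, uu]
  have τv : τ vv = g := by simp [τ, vv]
  have τC : ∀ z, τ (C (C z)) = C (C (starRingEnd ℂ z)) := by intro z; simp [τ]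
  have hτi : ∀ b, τ (ii b) = ii (σ b) := by
    intro b
    have : τ.comp (ii : BB →+* RR) = (ii : BB →+* RR).comp σ := by
      apply BB_hom_ext
      · intro z
        show τ (ii _) = ii (σ _)
        rw [h.hC, ii_C, ii_C, τC]
      · show τ (ii _) = ii (σ _)
        rw [ii_x, map_pow, τu, hf]
      · show τ (ii _) = ii (σ _)
        rw [ii_y, map_pow, τv, hg]
      · show τ (ii _) = ii (σ _)
        rw [ii_z, map_mul, τu, τv, hfg]
    exact congrArg (fun φ => φ b) this
  have hττi : ∀ b, τ (τ (ii b)) = ii b := by intro b; rw [hτi, hτi, h.hsq]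
  have hid : ∀ b, (∀ z, b = C (C z) → τ (τ b) = b) := by
    rintro _ z rfl; rw [τC, τC, Complex.conj_conj]
  refine ⟨τ, ⟨τC, ?_, ?_⟩, hτi⟩
  · have hu : τ (τ uu) = uu ∨ τ (τ uu) = -uu := by
      apply sq_eq_sq_iff_eq_or_eq_neg.1
      rw [← map_pow, ← map_pow, ← ii_x, hττi]
    have hv : τ (τ vv) = vv ∨ τ (τ vv) = -vv := by
      apply sq_eq_sq_iff_eq_or_eq_neg.1
      rw [← map_pow, ← map_pow, ← ii_y, hττi]
    have huv : τ (τ uu) * τ (τ vv) = uu * vv := by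
      rw [← map_mul, ← map_mul, ← ii_z, hττi]
    have hne : uu * vv ≠ 0 := mul_ne_zero uu_ne vv_ne
    rcases hu with hu | hu <;> rcases hv with hv | hv
    · left
      intro b
      have : τ.comp τ = RingHom.id _ := by
        apply RR_hom_ext
        · intro z; exact hid _ z rfl
        · exact hu
        · exact hv
      exact congrArg (fun φ => φ b) this
    · exfalso; rw [hu, hv] at huv; exact hne (self_eq_neg.1 (by linear_combination -huv))
    · exfalso; rw [hu, hv] at huv; exact hne (self_eq_neg.1 (by linear_combination -huv))
    · right
      intro b
      have : τ.comp τ = (NN : RR →+* RR) := by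
        apply RR_hom_ext
        · intro z; exact (hid _ z rfl).trans (NN_CC z).symm
        · exact hu.trans NN_uu.symm
        · exact hv.trans NN_vv.symm
      exact congrArg (fun φ => φ b) this
  · intro b
    have : τ.comp (NN : RR →+* RR) = (NN : RR →+* RR).comp τ := by
      apply RR_hom_ext
      · intro z
        show τ (NN _) = NN (τ _)
        rw [NN_CC, τC, NN_CC]
      · show τ (NN _) = NN (τ _)
        rw [NN_uu, map_neg, τu, hfo]
      · show τ (NN _) = NN (τ _)
        rw [NN_vv, map_neg, τv, hgo]
    exact congrArg (fun φ => φ b) this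

def Concl2 (τ : RR →+* RR) : Prop := ∃ x y : RR, NN x = -x ∧ NN y = -y ∧
  Algebra.adjoin ℂ {x, y} = ⊤ ∧
  ((τ x = x ∧ τ y = y) ∨ (τ x = y ∧ τ y = -x))

theorem Concl.two {τ : RR →+* RR} (hC : ∀ z, τ (C (C z)) = C (C (starRingEnd ℂ z))) (h : Concl τ) : Concl2 τ := by
  obtain ⟨x, y, hx, hy, had, h | h | h⟩ := h
  · exact ⟨x, y, hx, hy, had, Or.inl h⟩
  · refine ⟨x + y, C (C Complex.I) * (x - y), ?_, ?_, ?_, Or.inl ⟨?_, ?_⟩⟩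
    · rw [map_add, hx, hy]; ring
    · rw [map_mul, map_sub, hx, hy, NN_CC]; ring
    · rw [eq_top_iff, ← had, Algebra.adjoin_le_iff]
      set S := Algebra.adjoin ℂ {x + y, C (C Complex.I) * (x - y)}
      have hCC : ∀ z : ℂ, (C (C z) : RR) ∈ S := fun z => S.algebraMap_mem z
      have h1 : x + y ∈ S := Algebra.subset_adjoin (by simp)
      have h2 : C (C Complex.I) * (x - y) ∈ S := Algebra.subset_adjoin (by simp)
      have h3 : x - y ∈ S := by
        have := S.mul_mem (hCC (-Complex.I)) h2
        rw [← mul_assoc, ← C_mul, ← C_mul, neg_mul, Complex.I_mul_I] at this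
        simpa using this
      have e : (C (C (1/2 : ℂ)) : RR) * 2 = 1 := by
        rw [show (2 : RR) = C (C 2) from rfl, ← C_mul, ← C_mul]; norm_num
      rintro w (rfl | rfl)
      · have := S.mul_mem (hCC (1/2)) (S.add_mem h1 h3)
        have e2 : C (C (1 / 2 : ℂ)) * (w + y + (w - y)) = w := by linear_combination w * e
        rwa [e2] at this
      · have := S.mul_mem (hCC (1/2)) (S.sub_mem h1 h3)
        have e2 : C (C (1 / 2 : ℂ)) * (x + w - (x - w)) = w := by linear_combination w * e
        rwa [e2] at this
    · rw [map_add, h.1, h.2, add_comm]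
    · rw [map_mul, map_sub, h.1, h.2, hC, Complex.conj_I]; simp only [C_neg]; ring
  · exact ⟨x, y, hx, hy, had, Or.inr h⟩

/-- main consequence -/
theorem Sig.std {σ : BB →+* BB} (h : Sig σ) : ∃ θ : BB ≃ₐ[ℂ] BB,
    (σ (θ bx) = θ bx ∧ σ (θ by') = θ by' ∧ σ (θ bz) = θ bz) ∨
    (σ (θ bx) = θ by' ∧ σ (θ by') = θ bx ∧ σ (θ bz) = - θ bz) := by
  obtain ⟨τ, hτ, hτi⟩ := h.lift
  obtain ⟨x, y, hx, hy, had, hxy⟩ := (linearize _ τ hτ rfl).two hτ.hC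
  obtain ⟨p, hp⟩ := even_mem (f := x^2) (by rw [map_pow, hx]; ring)
  obtain ⟨q, hq⟩ := even_mem (f := y^2) (by rw [map_pow, hy]; ring)
  obtain ⟨r, hr⟩ := even_mem (f := x * y) (by rw [map_mul, hx, hy]; ring)
  have hpqr : p * q = r^2 := by
    apply ii_inj; rw [map_mul, map_pow, hp, hq, hr]; ring
  let φ : RR →ₐ[ℂ] RR := aevalAeval y x
  have φu : φ uu = x := aevalAeval_Y _ _
  have φv : φ vv = y := aevalAeval_X _ _
  have φC : ∀ z, φ (C (C z)) = C (C z) := fun z => φ.commutes z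
  have hφs : ∀ w, ∃ f, φ f = w := by
    intro w
    have : φ.range = ⊤ := by
      rw [eq_top_iff, ← had, Algebra.adjoin_le_iff]
      rintro w (rfl | rfl)
      · exact ⟨uu, φu⟩
      · exact ⟨vv, φv⟩
    have hw : w ∈ φ.range := by rw [this]; trivial
    exact hw
  have hφN : ∀ f, φ (NN f) = NN (φ f) := by
    intro f
    have : (φ : RR →+* RR).comp (NN : RR →+* RR) = (NN : RR →+* RR).comp (φ : RR →+* RR) := by
      apply RR_hom_ext
      · intro z
        show φ (NN _) = NN (φ _)
        rw [NN_CC, φC, NN_CC]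
      · show φ (NN _) = NN (φ _)
        rw [NN_uu, map_neg, φu, hx]
      · show φ (NN _) = NN (φ _)
        rw [NN_vv, map_neg, φv, hy]
    exact congrArg (fun φ => φ f) this
  let θ : BB →ₐ[ℂ] BB := BBlift p q r hpqr
  have hθ : ∀ b, ii (θ b) = φ (ii b) := by
    intro b
    have : (ii : BB →+* RR).comp (θ : BB →+* BB) = (φ : RR →+* RR).comp (ii : BB →+* RR) := by
      apply BB_hom_ext
      · intro z
        show ii (θ _) = φ (ii _)
        rw [θ.commutes, ii_C, φC]
      · show ii (θ _) = φ (ii _)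
        rw [BBlift_x, ii_x, map_pow, φu, hp]
      · show ii (θ _) = φ (ii _)
        rw [BBlift_y, ii_y, map_pow, φv, hq]
      · show ii (θ _) = φ (ii _)
        rw [BBlift_z, ii_z, map_mul, φu, φv, hr]
    exact congrArg (fun φ => φ b) this
  have hθs : Function.Surjective θ := by
    intro b
    obtain ⟨f, hf⟩ := hφs (ii b)
    obtain ⟨t, ht⟩ := add_NN_mem f
    have ht' : ii t = f + NN f := ht
    refine ⟨(1/2 : ℂ) • t, ?_⟩
    apply ii_inj
    rw [hθ, map_smul, ht', map_smul, map_add, hφN, hf, NN_ii, ← two_smul ℂ, smul_smul]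
    norm_num
  have hθi : Function.Injective θ := noeth_inj (θ : BB →+* BB) hθs
  have hb : Function.Bijective θ := ⟨hθi, hθs⟩
  refine ⟨AlgEquiv.ofBijective θ hb, ?_⟩
  have e1 : AlgEquiv.ofBijective θ hb bx = p := BBlift_x _ _ _ hpqr
  have e2 : AlgEquiv.ofBijective θ hb by' = q := BBlift_y _ _ _ hpqr
  have e3 : AlgEquiv.ofBijective θ hb bz = r := BBlift_z _ _ _ hpqr
  rw [e1, e2, e3]
  rcases hxy with ⟨h1, h2⟩ | ⟨h1, h2⟩
  · left
    refine ⟨?_, ?_, ?_⟩ <;> apply ii_inj <;> rw [← hτi]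
    · rw [hp, map_pow, h1]
    · rw [hq, map_pow, h2]
    · rw [hr, map_mul, h1, h2]
  · right
    refine ⟨?_, ?_, ?_⟩ <;> apply ii_inj <;> rw [← hτi]
    · rw [hp, hq, map_pow, h1]
    · rw [hp, hq, map_pow, h2]; ring
    · rw [map_neg, hr, map_mul, h1, h2]; ring
end

section
open scoped TensorProduct

noncomputable def cc (A : Type) [CommRing A] [Algebra ℝ A] : (ℂ ⊗[ℝ] A) →ₐ[ℝ] (ℂ ⊗[ℝ] A) :=
  Algebra.TensorProduct.map (Complex.conjAe : ℂ →ₐ[ℝ] ℂ) (AlgHom.id ℝ A)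

section
variable {A : Type} [CommRing A] [Algebra ℝ A]

theorem cc_tmul (z : ℂ) (a : A) : cc A (z ⊗ₜ a) = (starRingEnd ℂ z) ⊗ₜ a := by
  simp [cc]

theorem cc_cc (t : ℂ ⊗[ℝ] A) : cc A (cc A t) = t := by
  induction t using TensorProduct.induction_on with
  | zero => simp
  | tmul z a => simp [cc_tmul]
  | add x y hx hy => rw [map_add, map_add, hx, hy]

theorem cc_C (z : ℂ) : cc A (algebraMap ℂ _ z) = algebraMap ℂ _ (starRingEnd ℂ z) := cc_tmul z 1

theorem cc_add_mem (t : ℂ ⊗[ℝ] A) : ∃ a : A, (1:ℂ) ⊗ₜ[ℝ] a = t + cc A t := by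
  induction t using TensorProduct.induction_on with
  | zero => exact ⟨0, by simp⟩
  | tmul z a =>
    refine ⟨(2 * z.re) • a, ?_⟩
    rw [cc_tmul, ← TensorProduct.add_tmul, Complex.add_conj, ← TensorProduct.smul_tmul]
    congr 1
    simp
  | add x y hx hy =>
    obtain ⟨a, ha⟩ := hx
    obtain ⟨b, hb⟩ := hy
    exact ⟨a + b, by rw [TensorProduct.tmul_add, ha, hb, map_add]; abel⟩

theorem cc_fixed {t : ℂ ⊗[ℝ] A} (h : cc A t = t) : ∃ a : A, (1:ℂ) ⊗ₜ[ℝ] a = t := by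
  obtain ⟨a, ha⟩ := cc_add_mem t
  refine ⟨(1/2 : ℝ) • a, ?_⟩
  rw [TensorProduct.tmul_smul, ha, h, ← two_smul ℝ, smul_smul]
  norm_num

theorem inc_inj : Function.Injective (Algebra.TensorProduct.includeRight : A →ₐ[ℝ] ℂ ⊗[ℝ] A) :=
  Algebra.TensorProduct.includeRight_injective (algebraMap ℝ ℂ).injective

theorem descend {B : Type} [CommRing B] [Algebra ℝ B] (E : (ℂ ⊗[ℝ] A) ≃ₐ[ℂ] (ℂ ⊗[ℝ] B))
    (hE : ∀ t, E (cc A t) = cc B (E t)) : Nonempty (A ≃ₐ[ℝ] B) := by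
  let f : A →ₐ[ℝ] ℂ ⊗[ℝ] B := (E.restrictScalars ℝ : (ℂ ⊗[ℝ] A) →ₐ[ℝ] (ℂ ⊗[ℝ] B)).comp
    (Algebra.TensorProduct.includeRight : A →ₐ[ℝ] ℂ ⊗[ℝ] A)
  have hf : Function.Injective f := E.injective.comp inc_inj
  have hfa : ∀ a, f a = E (1 ⊗ₜ a) := fun a => rfl
  have hr : f.range = (Algebra.TensorProduct.includeRight : B →ₐ[ℝ] ℂ ⊗[ℝ] B).range := by
    ext t
    constructor
    · rintro ⟨a, rfl⟩
      apply cc_fixed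
      show cc B (f a) = f a
      rw [hfa, ← hE, cc_tmul, map_one]
    · rintro ⟨b, rfl⟩
      obtain ⟨a, ha⟩ := cc_fixed (A := A) (t := E.symm (1 ⊗ₜ b)) (by
        apply E.injective
        rw [hE, E.apply_symm_apply, cc_tmul, map_one])
      refine ⟨a, ?_⟩
      show f a = 1 ⊗ₜ b
      rw [hfa, ha, E.apply_symm_apply]
  exact ⟨(AlgEquiv.ofInjective f hf).trans ((Subalgebra.equivOfEq _ _ hr).trans
    (AlgEquiv.ofInjective _ inc_inj).symm)⟩
end

abbrev TT (F : MvPolynomial (Fin 3) ℝ) := MvPolynomial (Fin 3) ℝ ⧸ Ideal.span {F}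
noncomputable def tt (F : MvPolynomial (Fin 3) ℝ) (i : Fin 3) : TT F := Ideal.Quotient.mk _ (MvPolynomial.X i)

section
variable {A : Type*} [CommRing A] [Algebra ℝ A]
noncomputable def TTlift (F : MvPolynomial (Fin 3) ℝ) (w : Fin 3 → A) (h : MvPolynomial.aeval w F = 0) : TT F →ₐ[ℝ] A :=
  Ideal.Quotient.liftₐ _ (MvPolynomial.aeval w) (by
    intro a ha
    have : Ideal.span {F} ≤ RingHom.ker (MvPolynomial.aeval (R := ℝ) w) := by
      rw [Ideal.span_le]
      rintro _ rfl
      exact h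
    exact this ha)

theorem TTlift_tt (F : MvPolynomial (Fin 3) ℝ) (w : Fin 3 → A) (h : MvPolynomial.aeval w F = 0) (i) :
    TTlift F w h (tt F i) = w i := by
  show MvPolynomial.aeval _ _ = _
  simp

theorem TT_ext {F : MvPolynomial (Fin 3) ℝ} {f g : TT F →ₐ[ℝ] A} (h : ∀ i, f (tt F i) = g (tt F i)) : f = g := by
  apply Ideal.Quotient.algHom_ext
  apply MvPolynomial.algHom_ext
  intro i; exact h i

theorem TT_rel (F : MvPolynomial (Fin 3) ℝ) : MvPolynomial.aeval (tt F) F = 0 := by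
  have : MvPolynomial.aeval (tt F) = Ideal.Quotient.mkₐ ℝ (Ideal.span {F}) := by
    apply MvPolynomial.algHom_ext; intro i; simp [tt]
  rw [this]
  exact Ideal.Quotient.eq_zero_iff_mem.2 (Ideal.subset_span rfl)

theorem TT_rel' (F : MvPolynomial (Fin 3) ℝ) (f : TT F →ₐ[ℝ] A) : MvPolynomial.aeval (fun i => f (tt F i)) F = 0 := by
  have := congrArg f (TT_rel F)
  rw [map_zero, ← AlgHom.comp_apply, MvPolynomial.comp_aeval] at this
  exact this
end

theorem TT_adjoin (F : MvPolynomial (Fin 3) ℝ) : Algebra.adjoin ℝ (Set.range (tt F)) = ⊤ := by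
  have h := congrArg (Subalgebra.map (Ideal.Quotient.mkₐ ℝ (Ideal.span {F})))
    (MvPolynomial.adjoin_range_X (R := ℝ) (σ := Fin 3))
  rw [AlgHom.map_adjoin, ← Set.range_comp, Algebra.map_top,
    (AlgHom.range_eq_top _).2 (Ideal.Quotient.mkₐ_surjective ℝ _)] at h
  exact h

section
variable {T : Type} [CommRing T] [Algebra ℝ T] (t : Fin 3 → T)
noncomputable def aa (i : Fin 3) : ℂ ⊗[ℝ] T := 1 ⊗ₜ t i

theorem cc_aa (i : Fin 3) : cc _ (aa t i) = aa t i := by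
  rw [aa, cc_tmul, map_one]

theorem mkE (ht : Algebra.adjoin ℝ (Set.range t) = ⊤) (W : Fin 3 → BB) (hF : ∃ f : T →ₐ[ℝ] BB, ∀ i, f (t i) = W i)
    (x y z : ℂ ⊗[ℝ] T) (h : x * y = z^2)
    (h1 : ∀ φ : (ℂ ⊗[ℝ] T) →ₐ[ℂ] BB, (∀ i, φ (aa t i) = W i) → φ x = bx ∧ φ y = by' ∧ φ z = bz)
    (h2 : ∀ ψ : BB →ₐ[ℂ] (ℂ ⊗[ℝ] T), ψ bx = x → ψ by' = y → ψ bz = z → ∀ i, ψ (W i) = aa t i) :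
    ∃ E : (ℂ ⊗[ℝ] T) ≃ₐ[ℂ] BB, E.symm bx = x ∧ E.symm by' = y ∧ E.symm bz = z := by
  obtain ⟨f, hf⟩ := hF
  let φ : (ℂ ⊗[ℝ] T) →ₐ[ℂ] BB := Algebra.TensorProduct.lift (Algebra.ofId ℂ BB) f
    (fun _ _ => Commute.all _ _)
  have hφ : ∀ i, φ (aa t i) = W i := by
    intro i; simp [φ, aa, hf]
  let ψ : BB →ₐ[ℂ] (ℂ ⊗[ℝ] T) := BBlift x y z h
  have ψx : ψ bx = x := BBlift_x _ _ _ h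
  have ψy : ψ by' = y := BBlift_y _ _ _ h
  have ψz : ψ bz = z := BBlift_z _ _ _ h
  obtain ⟨h1x, h1y, h1z⟩ := h1 φ hφ
  have h2' := h2 ψ ψx ψy ψz
  refine ⟨AlgEquiv.ofAlgHom φ ψ ?_ ?_, ψx, ψy, ψz⟩
  · apply AlgHom.coe_ringHom_injective
    apply BB_hom_ext
    · intro z; exact ((φ.comp ψ).commutes z)
    · show φ (ψ _) = _
      rw [ψx, h1x]; rfl
    · show φ (ψ _) = _
      rw [ψy, h1y]; rfl
    · show φ (ψ _) = _
      rw [ψz, h1z]; rfl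
  · apply Algebra.TensorProduct.ext
    · ext
    · apply AlgHom.ext_of_adjoin_eq_top ht
      rintro _ ⟨i, rfl⟩
      show ψ (φ (aa t i)) = aa t i
      rw [hφ, h2']
end

theorem half_rel (A : Type*) [CommRing A] [Algebra ℂ A] : algebraMap ℂ A (1/2) * 2 = 1 := by
  rw [show (2 : A) = algebraMap ℂ A 2 from (map_ofNat _ _).symm, ← map_mul]; norm_num
theorem I_rel (A : Type*) [CommRing A] [Algebra ℂ A] : algebraMap ℂ A Complex.I ^ 2 = -1 := by
  rw [← map_pow, Complex.I_sq]; simp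

open MvPolynomial in
theorem iso0 {T : Type} [CommRing T] [Algebra ℝ T] (t : Fin 3 → T) (ht : Algebra.adjoin ℝ (Set.range t) = ⊤)
    (hrel : t 0 ^ 2 + t 1 ^ 2 + t 2 ^ 2 = 0)
    (hl : ∀ W : Fin 3 → BB, W 0 ^ 2 + W 1 ^ 2 + W 2 ^ 2 = 0 → ∃ f : T →ₐ[ℝ] BB, ∀ i, f (t i) = W i) :
    ∃ E : (ℂ ⊗[ℝ] T) ≃ₐ[ℂ] BB, cc _ (E.symm bx) = E.symm by' ∧ cc _ (E.symm by') = E.symm bx ∧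
      cc _ (E.symm bz) = - E.symm bz := by
  have hj := I_rel BB
  have hh := half_rel BB
  have hj' := I_rel (ℂ ⊗[ℝ] T)
  have hh' := half_rel (ℂ ⊗[ℝ] T)
  have hr : aa t 0 ^ 2 + aa t 1 ^ 2 + aa t 2 ^ 2 = 0 := by
    have := congrArg (Algebra.TensorProduct.includeRight : T →ₐ[ℝ] ℂ ⊗[ℝ] T) hrel
    rw [map_add, map_add, map_pow, map_pow, map_pow, map_zero] at this
    exact this
  obtain ⟨E, hx, hy, hz⟩ := mkE t ht
    ![algebraMap ℂ BB (1/2) * (bx + by'), -algebraMap ℂ BB Complex.I * algebraMap ℂ BB (1/2) * (bx - by'),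
      -algebraMap ℂ BB Complex.I * bz]
    (by
      apply hl
      simp only [Matrix.cons_val]
      have := bxy
      generalize algebraMap ℂ BB (1/2) = H at *
      generalize algebraMap ℂ BB Complex.I = J at *
      linear_combination (bz^2 + H^2*(bx-by')^2) * hj + this + (bx*by') * (H*2+1) * hh)
    (aa t 0 + algebraMap ℂ _ Complex.I * aa t 1) (aa t 0 - algebraMap ℂ _ Complex.I * aa t 1)
    (algebraMap ℂ _ Complex.I * aa t 2)
    (by linear_combination hr - ((aa t 1)^2 + (aa t 2)^2) * hj')
    (by
      intro φ hφ
      have h0 := hφ 0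
      have h1 := hφ 1
      have h2 := hφ 2
      simp only [Matrix.cons_val] at h0 h1 h2
      simp only [map_add, map_sub, map_mul, h0, h1, h2, AlgHom.commutes]
      generalize algebraMap ℂ BB (1/2) = H at *
      generalize algebraMap ℂ BB Complex.I = J at *
      refine ⟨?_, ?_, ?_⟩
      · linear_combination (-H*(bx-by'))*hj + bx * hh
      · linear_combination (H*(bx-by'))*hj + by' * hh
      · linear_combination (-bz) * hj)
    (by
      intro ψ h0 h1 h2 i
      fin_cases i
      · simp only [Fin.zero_eta, Matrix.cons_val, map_add, map_sub, map_mul, map_neg, h0, h1, h2, AlgHom.commutes]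
        linear_combination (aa t 0) * hh'
      · simp only [Fin.mk_one, Matrix.cons_val, map_add, map_sub, map_mul, map_neg, h0, h1, h2, AlgHom.commutes]
        linear_combination (aa t 1) * hh' - 2 * algebraMap ℂ _ (1/2) * aa t 1 * hj'
      · simp only [Fin.reduceFinMk, Matrix.cons_val, map_add, map_sub, map_mul, map_neg, h0, h1, h2, AlgHom.commutes]
        linear_combination (-aa t 2) * hj')
  refine ⟨E, ?_, ?_, ?_⟩
  · rw [hx, hy]; simp only [map_add, map_mul, cc_aa, cc_C, Complex.conj_I, map_neg]; ring
  · rw [hx, hy]; simp only [map_sub, map_mul, cc_aa, cc_C, Complex.conj_I, map_neg]; ring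
  · rw [hz]; simp only [map_mul, cc_aa, cc_C, Complex.conj_I, map_neg]; ring

open MvPolynomial in
theorem iso1 {T : Type} [CommRing T] [Algebra ℝ T] (t : Fin 3 → T) (ht : Algebra.adjoin ℝ (Set.range t) = ⊤)
    (hrel : t 0 ^ 2 - t 1 ^ 2 - t 2 ^ 2 = 0)
    (hl : ∀ W : Fin 3 → BB, W 0 ^ 2 - W 1 ^ 2 - W 2 ^ 2 = 0 → ∃ f : T →ₐ[ℝ] BB, ∀ i, f (t i) = W i) :
    ∃ E : (ℂ ⊗[ℝ] T) ≃ₐ[ℂ] BB, cc _ (E.symm bx) = E.symm bx ∧ cc _ (E.symm by') = E.symm by' ∧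
      cc _ (E.symm bz) = E.symm bz := by
  have hh := half_rel BB
  have hh' := half_rel (ℂ ⊗[ℝ] T)
  have hr : aa t 0 ^ 2 - aa t 1 ^ 2 - aa t 2 ^ 2 = 0 := by
    have := congrArg (Algebra.TensorProduct.includeRight : T →ₐ[ℝ] ℂ ⊗[ℝ] T) hrel
    rw [map_sub, map_sub, map_pow, map_pow, map_pow, map_zero] at this
    exact this
  obtain ⟨E, hx, hy, hz⟩ := mkE t ht
    ![algebraMap ℂ BB (1/2) * (bx + by'), algebraMap ℂ BB (1/2) * (bx - by'), bz]
    (by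
      apply hl
      simp only [Matrix.cons_val]
      have := bxy
      generalize algebraMap ℂ BB (1/2) = H at *
      linear_combination this + (bx*by') * (H*2+1) * hh)
    (aa t 0 + aa t 1) (aa t 0 - aa t 1) (aa t 2)
    (by linear_combination hr)
    (by
      intro φ hφ
      have h0 := hφ 0
      have h1 := hφ 1
      have h2 := hφ 2
      simp only [Matrix.cons_val] at h0 h1 h2
      simp only [map_add, map_sub, h0, h1, h2]
      generalize algebraMap ℂ BB (1/2) = H at *
      refine ⟨?_, ?_, ?_⟩
      · linear_combination bx * hh
      · linear_combination by' * hh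
      · trivial)
    (by
      intro ψ h0 h1 h2 i
      fin_cases i
      · simp only [Fin.zero_eta, Matrix.cons_val, map_add, map_sub, map_mul, map_neg, h0, h1, h2, AlgHom.commutes]
        linear_combination (aa t 0) * hh'
      · simp only [Fin.mk_one, Matrix.cons_val, map_add, map_sub, map_mul, map_neg, h0, h1, h2, AlgHom.commutes]
        linear_combination (aa t 1) * hh'
      · simp only [Fin.reduceFinMk, Matrix.cons_val, map_add, map_sub, map_mul, map_neg, h0, h1, h2, AlgHom.commutes])
  refine ⟨E, ?_, ?_, ?_⟩
  · rw [hx]; simp only [map_add, cc_aa]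
  · rw [hy]; simp only [map_sub, cc_aa]
  · rw [hz]; simp only [cc_aa]

open MvPolynomial in
theorem noniso (F G : MvPolynomial (Fin 3) ℝ) (hF : F = X 0 ^ 2 + X 1 ^ 2 + X 2 ^ 2)
    (hG : G = X 0 ^ 2 - X 1 ^ 2 - X 2 ^ 2) (e : TT F ≃ₐ[ℝ] TT G) : False := by
  have key : ∀ f : TT F →ₐ[ℝ] ℝ, ∀ i, f (tt F i) = 0 := by
    intro f i
    have h := (congrArg (aeval fun i => f (tt F i)) hF).symm.trans (TT_rel' F f)
    simp only [map_add, map_pow, aeval_X] at h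
    fin_cases i
    · show f (tt F 0) = 0
      nlinarith [sq_nonneg (f (tt F 0)), sq_nonneg (f (tt F 1)), sq_nonneg (f (tt F 2))]
    · show f (tt F 1) = 0
      nlinarith [sq_nonneg (f (tt F 0)), sq_nonneg (f (tt F 1)), sq_nonneg (f (tt F 2))]
    · show f (tt F 2) = 0
      nlinarith [sq_nonneg (f (tt F 0)), sq_nonneg (f (tt F 1)), sq_nonneg (f (tt F 2))]
  let f : TT G →ₐ[ℝ] ℝ := TTlift G ![1,1,0] (by conv_lhs => rw [hG]
                                                simp)
  let g : TT G →ₐ[ℝ] ℝ := TTlift G ![0,0,0] (by conv_lhs => rw [hG]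
                                                simp)
  have h1 : f.comp (e : TT F →ₐ[ℝ] TT G) = g.comp (e : TT F →ₐ[ℝ] TT G) := by
    apply TT_ext
    intro i; rw [key, key]
  have h2 := congrArg (fun φ : TT F →ₐ[ℝ] ℝ => φ (e.symm (tt G 0))) h1
  simp [f, g, TTlift_tt] at h2

theorem descend' {A : Type} [CommRing A] [Algebra ℝ A] (e : (ℂ ⊗[ℝ] A) ≃ₐ[ℂ] BB) :
    ∃ e' : (ℂ ⊗[ℝ] A) ≃ₐ[ℂ] BB,
    (cc A (e'.symm bx) = e'.symm bx ∧ cc A (e'.symm by') = e'.symm by' ∧ cc A (e'.symm bz) = e'.symm bz) ∨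
    (cc A (e'.symm bx) = e'.symm by' ∧ cc A (e'.symm by') = e'.symm bx ∧ cc A (e'.symm bz) = - e'.symm bz) := by
  let σ : BB →+* BB := (e : (ℂ ⊗[ℝ] A) →+* BB).comp ((cc A : (ℂ ⊗[ℝ] A) →+* (ℂ ⊗[ℝ] A)).comp (e.symm : BB →+* (ℂ ⊗[ℝ] A)))
  have hσ : ∀ b, σ b = e (cc A (e.symm b)) := fun b => rfl
  have h : Sig σ := by
    refine ⟨?_, ?_⟩
    · intro z; rw [hσ, e.symm.commutes, cc_C, e.commutes]
    · intro b; rw [hσ, hσ, e.symm_apply_apply, cc_cc, e.apply_symm_apply]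
  obtain ⟨θ, hθ⟩ := h.std
  refine ⟨e.trans θ.symm, ?_⟩
  have hs : ∀ b, (e.trans θ.symm).symm b = e.symm (θ b) := fun b => rfl
  simp only [hs]
  have hσ' : ∀ b, cc A (e.symm b) = e.symm (σ b) := by intro b; rw [hσ, e.symm_apply_apply]
  simp only [hσ']
  rcases hθ with ⟨h1, h2, h3⟩ | ⟨h1, h2, h3⟩
  · left; rw [h1, h2, h3]; exact ⟨rfl, rfl, rfl⟩
  · right; rw [h1, h2, h3]; exact ⟨rfl, rfl, map_neg _ _⟩

theorem glue {A B : Type} [CommRing A] [Algebra ℝ A] [CommRing B] [Algebra ℝ B]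
    (e : (ℂ ⊗[ℝ] A) ≃ₐ[ℂ] BB) (E : (ℂ ⊗[ℝ] B) ≃ₐ[ℂ] BB)
    (hx : e (cc A (e.symm bx)) = E (cc B (E.symm bx))) (hy : e (cc A (e.symm by')) = E (cc B (E.symm by')))
    (hz : e (cc A (e.symm bz)) = E (cc B (E.symm bz))) : Nonempty (A ≃ₐ[ℝ] B) := by
  have : (e : (ℂ ⊗[ℝ] A) →+* BB).comp ((cc A : (ℂ ⊗[ℝ] A) →+* (ℂ ⊗[ℝ] A)).comp (e.symm : BB →+* (ℂ ⊗[ℝ] A))) =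
    (E : (ℂ ⊗[ℝ] B) →+* BB).comp ((cc B : (ℂ ⊗[ℝ] B) →+* (ℂ ⊗[ℝ] B)).comp (E.symm : BB →+* (ℂ ⊗[ℝ] B))) := by
    apply BB_hom_ext
    · intro z
      show e (cc A (e.symm _)) = E (cc B (E.symm _))
      rw [e.symm.commutes, E.symm.commutes, cc_C, cc_C, e.commutes, E.commutes]
    · exact hx
    · exact hy
    · exact hz
  have h : ∀ b, e (cc A (e.symm b)) = E (cc B (E.symm b)) := fun b => congrArg (fun φ => φ b) this
  apply descend (e.trans E.symm)
  intro t
  show E.symm (e (cc A t)) = cc B (E.symm (e t))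
  have := h (e t)
  rw [e.symm_apply_apply] at this
  rw [this, E.symm_apply_apply]
end

open MvPolynomial
open scoped TensorProduct

theorem E0ex (F : MvPolynomial (Fin 3) ℝ) (hF : F = X 0 ^ 2 + X 1 ^ 2 + X 2 ^ 2) :
    ∃ E : (ℂ ⊗[ℝ] TT F) ≃ₐ[ℂ] BB, cc _ (E.symm bx) = E.symm by' ∧
      cc _ (E.symm by') = E.symm bx ∧ cc _ (E.symm bz) = -E.symm bz := by
  refine iso0 (tt F) (TT_adjoin F) ?_ ?_
  · have := (congrArg (aeval (tt F)) hF).symm.trans (TT_rel F)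
    simpa only [map_add, map_pow, aeval_X] using this
  · intro W hW
    have h : aeval W F = 0 := by
      refine (congrArg (aeval W) hF).trans ?_
      simpa only [map_add, map_pow, aeval_X] using hW
    exact ⟨TTlift F W h, fun i => TTlift_tt F W h i⟩

theorem E1ex (F : MvPolynomial (Fin 3) ℝ) (hF : F = X 0 ^ 2 - X 1 ^ 2 - X 2 ^ 2) :
    ∃ E : (ℂ ⊗[ℝ] TT F) ≃ₐ[ℂ] BB, cc _ (E.symm bx) = E.symm bx ∧
      cc _ (E.symm by') = E.symm by' ∧ cc _ (E.symm bz) = E.symm bz := by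
  refine iso1 (tt F) (TT_adjoin F) ?_ ?_
  · have := (congrArg (aeval (tt F)) hF).symm.trans (TT_rel F)
    simpa only [map_sub, map_pow, aeval_X] using this
  · intro W hW
    have h : aeval W F = 0 := by
      refine (congrArg (aeval W) hF).trans ?_
      simpa only [map_sub, map_pow, aeval_X] using hW
    exact ⟨TTlift F W h, fun i => TTlift_tt F W h i⟩

/-- The complex surface `xy = z²` has exactly two isomorphism classes of real forms,
given by `x² + y² + z² = 0` and `x² - y² - z² = 0`. -/
theorem two_real_forms_of_cone :
    (∀ i j : Fin 2, i ≠ j →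
      IsEmpty ((MvPolynomial (Fin 3) ℝ ⧸ Ideal.span {cone8 i}) ≃ₐ[ℝ]
               (MvPolynomial (Fin 3) ℝ ⧸ Ideal.span {cone8 j}))) ∧
    (∀ i : Fin 2,
      IsRealForm (MvPolynomial (Fin 3) ℝ ⧸ Ideal.span {cone8 i})
        (MvPolynomial (Fin 3) ℂ ⧸
          Ideal.span {(X 0 * X 1 : MvPolynomial (Fin 3) ℂ) - X 2 ^ 2})) ∧
    (∀ (A : Type) [CommRing A] [Algebra ℝ A],
      IsRealForm A (MvPolynomial (Fin 3) ℂ ⧸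
          Ideal.span {(X 0 * X 1 : MvPolynomial (Fin 3) ℂ) - X 2 ^ 2}) →
      ∃ i : Fin 2, Nonempty (A ≃ₐ[ℝ] (MvPolynomial (Fin 3) ℝ ⧸ Ideal.span {cone8 i}))) := by
  have h0 : cone8 0 = X 0 ^ 2 + X 1 ^ 2 + X 2 ^ 2 := rfl
  have h1 : cone8 1 = X 0 ^ 2 - X 1 ^ 2 - X 2 ^ 2 := rfl
  obtain ⟨E0, a0, a1, a2⟩ := E0ex _ h0
  obtain ⟨E1, b0, b1, b2⟩ := E1ex _ h1
  refine ⟨?_, ?_, ?_⟩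
  · intro i j hij
    refine ⟨fun e => ?_⟩
    fin_cases i <;> fin_cases j
    · exact hij rfl
    · exact noniso _ _ h0 h1 e
    · exact noniso _ _ h0 h1 e.symm
    · exact hij rfl
  · intro i
    fin_cases i
    · exact ⟨E0⟩
    · exact ⟨E1⟩
  · rintro A _ _ ⟨e⟩
    obtain ⟨e', ⟨h, h', h''⟩ | ⟨h, h', h''⟩⟩ := descend' e
    · refine ⟨1, glue e' E1 ?_ ?_ ?_⟩
      · rw [h, b0, AlgEquiv.apply_symm_apply, AlgEquiv.apply_symm_apply]
      · rw [h', b1, AlgEquiv.apply_symm_apply, AlgEquiv.apply_symm_apply]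
      · rw [h'', b2, AlgEquiv.apply_symm_apply, AlgEquiv.apply_symm_apply]
    · refine ⟨0, glue e' E0 ?_ ?_ ?_⟩
      · rw [h, a0, AlgEquiv.apply_symm_apply, AlgEquiv.apply_symm_apply]
      · rw [h', a1, AlgEquiv.apply_symm_apply, AlgEquiv.apply_symm_apply]
      · rw [h'', a2, map_neg, map_neg, AlgEquiv.apply_symm_apply, AlgEquiv.apply_symm_apply]
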